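/- arXiv:1010.3433 — 5 statements merged into one kernel-verified Lean document; each statement's English description precedes it below -/
import Mathlib

section
/- Let 1 ≤ a < b, A ≤ 0, B ∈ ℝ, and let h ∈ C¹([a,b]) be complex valued. Then for all t > 0, |∫_a^b e^{itλ²} e^{iρ₊(λ)A} e^{iλB} h(λ) dλ| ≤ 30 (sup_{[a,b]}|h| + ∫_a^b |h'(λ)| dλ) t^{−1/2}. -/
open MeasureTheory Complex

/-- The function `ρ₊(λ)`: `(λ²−1)^{1/2}` for `λ > 1`, `i(1−λ²)^{1/2}` for `−1 ≤ λ ≤ 1`,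
`−(λ²−1)^{1/2}` for `λ < −1`. -/
noncomputable def rhoPlus (l : ℝ) : ℂ :=
  if 1 < l then (Real.sqrt (l ^ 2 - 1) : ℂ)
  else if l < -1 then -(Real.sqrt (l ^ 2 - 1) : ℂ)
  else Complex.I * (Real.sqrt (1 - l ^ 2) : ℂ)

/-- A differentiable function on `[c, d]` whose derivative is at least `μ` grows at least at
rate `μ`. -/
lemma mul_sub_le_sub_of_le_hasDerivAt {f f' : ℝ → ℝ} {c d μ : ℝ}
    (hf : ∀ x ∈ Set.Icc c d, HasDerivAt f (f' x) x) (hμ : ∀ x ∈ Set.Icc c d, μ ≤ f' x)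
    {x y : ℝ} (hx : x ∈ Set.Icc c d) (hy : y ∈ Set.Icc c d) (hxy : x ≤ y) :
    μ * (y - x) ≤ f y - f x := by
  refine (convex_Icc c d).mul_sub_le_image_sub_of_le_deriv
    (fun z hz => (hf z hz).continuousAt.continuousWithinAt) (fun z hz => ?_) (fun z hz => ?_)
    x hx y hy hxy
  · exact (hf z (interior_subset hz)).differentiableAt.differentiableWithinAt
  · rw [(hf z (interior_subset hz)).deriv]
    exact hμ z (interior_subset hz)

lemma norm_cexp_I_mul_ofReal (r : ℝ) : ‖cexp (I * r)‖ = 1 := by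
  rw [mul_comm, norm_exp_ofReal_mul_I]

/-- The integral of `exp (i φ)` is bounded by the length of the interval. -/
lemma norm_integral_cexp_I_mul_le (φ : ℝ → ℝ) {c d : ℝ} (hcd : c ≤ d) :
    ‖∫ x in c..d, cexp (I * φ x)‖ ≤ d - c := by
  have := intervalIntegral.norm_integral_le_of_norm_le_const (a := c) (b := d) (C := 1)
    (f := fun x => cexp (I * φ x)) (fun x _ => (norm_cexp_I_mul_ofReal _).le)
  rwa [one_mul, abs_of_nonneg (sub_nonneg.2 hcd)] at this

/-- First-derivative van der Corput estimate for a phase with increasing positive derivative. -/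
lemma norm_integral_cexp_le_of_le_deriv {φ φ' φ'' : ℝ → ℝ} {c d m : ℝ} (hcd : c ≤ d) (hm : 0 < m)
    (hφ : ∀ x ∈ Set.Icc c d, HasDerivAt φ (φ' x) x)
    (hφ' : ∀ x ∈ Set.Icc c d, HasDerivAt φ' (φ'' x) x)
    (hcont : ContinuousOn φ'' (Set.Icc c d))
    (hnn : ∀ x ∈ Set.Icc c d, 0 ≤ φ'' x) (hmc : m ≤ φ' c) :
    ‖∫ x in c..d, cexp (I * φ x)‖ ≤ 2 / m := by
  have hmem_c : c ∈ Set.Icc c d := Set.left_mem_Icc.2 hcd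
  have hmem_d : d ∈ Set.Icc c d := Set.right_mem_Icc.2 hcd
  have hge : ∀ x ∈ Set.Icc c d, m ≤ φ' x := fun x hx => by
    have := mul_sub_le_sub_of_le_hasDerivAt hφ' hnn hmem_c hx hx.1
    linarith
  have hpos : ∀ x ∈ Set.Icc c d, 0 < φ' x := fun x hx => hm.trans_le (hge x hx)
  have hφc : ContinuousOn φ (Set.Icc c d) :=
    fun x hx => (hφ x hx).continuousAt.continuousWithinAt
  have hφ'c : ContinuousOn φ' (Set.Icc c d) :=
    fun x hx => (hφ' x hx).continuousAt.continuousWithinAt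
  have hE : ContinuousOn (fun x => cexp (I * φ x)) (Set.Icc c d) := by fun_prop
  have hq : ContinuousOn (fun x => φ'' x / φ' x ^ 2) (Set.Icc c d) :=
    hcont.div (hφ'c.pow 2) (fun x hx => (pow_pos (hpos x hx) 2).ne')
  have hR : ContinuousOn (fun x => cexp (I * φ x) * (I * ((φ'' x / φ' x ^ 2 : ℝ) : ℂ)))
      (Set.Icc c d) :=
    hE.mul (continuousOn_const.mul (continuous_ofReal.comp_continuousOn hq))
  have hG : ∀ x ∈ Set.uIcc c d, HasDerivAt (fun y => cexp (I * φ y) * (-I * (((φ' y)⁻¹ : ℝ) : ℂ)))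
      (cexp (I * φ x) + cexp (I * φ x) * (I * ((φ'' x / φ' x ^ 2 : ℝ) : ℂ))) x := by
    intro x hx
    rw [Set.uIcc_of_le hcd] at hx
    have hne : (φ' x : ℂ) ≠ 0 := ofReal_ne_zero.2 (hpos x hx).ne'
    have h1 := (((hφ x hx).ofReal_comp).const_mul I).cexp
    have h2 := ((((hφ' x hx).inv (hpos x hx).ne').ofReal_comp).const_mul (-I))
    refine (h1.mul h2).congr_deriv ?_
    simp only [Pi.inv_apply]
    push_cast
    field_simp
    linear_combination (-(φ' x : ℂ) ^ 2) * I_sq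
  have hmain := intervalIntegral.integral_eq_sub_of_hasDerivAt hG
    ((hE.add hR).intervalIntegrable_of_Icc hcd)
  rw [intervalIntegral.integral_add (hE.intervalIntegrable_of_Icc hcd)
    (hR.intervalIntegrable_of_Icc hcd)] at hmain
  have hq_int : ∫ x in c..d, φ'' x / φ' x ^ 2 = (φ' c)⁻¹ - (φ' d)⁻¹ := by
    rw [intervalIntegral.integral_eq_sub_of_hasDerivAt (f := fun x => -(φ' x)⁻¹) _
      (hq.intervalIntegrable_of_Icc hcd)]
    · ring
    · intro x hx
      rw [Set.uIcc_of_le hcd] at hx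
      exact ((hφ' x hx).inv (hpos x hx).ne').neg.congr_deriv (by ring)
  have hrem : ‖∫ x in c..d, cexp (I * φ x) * (I * ((φ'' x / φ' x ^ 2 : ℝ) : ℂ))‖
      ≤ (φ' c)⁻¹ - (φ' d)⁻¹ := by
    rw [← hq_int]
    refine intervalIntegral.norm_integral_le_of_norm_le hcd ?_ (hq.intervalIntegrable_of_Icc hcd)
    refine Filter.Eventually.of_forall fun x hx => ?_
    have hx' := Set.Ioc_subset_Icc_self hx
    rw [norm_mul, norm_mul, norm_cexp_I_mul_ofReal, norm_I, one_mul, one_mul, norm_real,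
      Real.norm_of_nonneg (div_nonneg (hnn x hx') (sq_nonneg _))]
  have hend : ∀ x ∈ Set.Icc c d,
      ‖cexp (I * φ x) * (-I * (((φ' x)⁻¹ : ℝ) : ℂ))‖ = (φ' x)⁻¹ := fun x hx => by
    rw [norm_mul, norm_mul, norm_cexp_I_mul_ofReal, norm_neg, norm_I, one_mul, one_mul, norm_real,
      Real.norm_of_nonneg (inv_nonneg.2 (hpos x hx).le)]
  rw [eq_sub_of_add_eq hmain]
  calc _ ≤ (φ' d)⁻¹ + (φ' c)⁻¹ + ((φ' c)⁻¹ - (φ' d)⁻¹) := by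
        refine (norm_sub_le _ _).trans (add_le_add ((norm_sub_le _ _).trans_eq ?_) hrem)
        rw [hend c hmem_c, hend d hmem_d]
    _ = 2 * (φ' c)⁻¹ := by ring
    _ ≤ 2 / m := by
        rw [div_eq_mul_inv]
        gcongr

/-- Second-derivative van der Corput estimate when the phase is nondecreasing. -/
lemma norm_integral_cexp_le_of_deriv_nonneg {φ φ' φ'' : ℝ → ℝ} {c d s : ℝ} (hcd : c ≤ d)
    (hs : 0 < s)
    (hφ : ∀ x ∈ Set.Icc c d, HasDerivAt φ (φ' x) x)
    (hφ' : ∀ x ∈ Set.Icc c d, HasDerivAt φ' (φ'' x) x)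
    (hcont : ContinuousOn φ'' (Set.Icc c d))
    (hge : ∀ x ∈ Set.Icc c d, 2 / s ^ 2 ≤ φ'' x) (h0 : 0 ≤ φ' c) :
    ‖∫ x in c..d, cexp (I * φ x)‖ ≤ 2 * s := by
  rcases le_total d (c + s) with hd | hd
  · exact (norm_integral_cexp_I_mul_le φ hcd).trans (by linarith)
  have hcs : c ≤ c + s := by linarith
  have hsub : Set.Icc (c + s) d ⊆ Set.Icc c d := Set.Icc_subset_Icc_left hcs
  have hE : ContinuousOn (fun x => cexp (I * φ x)) (Set.Icc c d) := by
    have : ContinuousOn φ (Set.Icc c d) :=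
      fun x hx => (hφ x hx).continuousAt.continuousWithinAt
    fun_prop
  have hgrow := mul_sub_le_sub_of_le_hasDerivAt hφ' hge (Set.left_mem_Icc.2 hcd)
    (show c + s ∈ Set.Icc c d from ⟨hcs, hd⟩) hcs
  have heq : 2 / s ^ 2 * (c + s - c) = 2 / s := by field_simp; ring
  have htail := norm_integral_cexp_le_of_le_deriv (m := 2 / s) hd (by positivity)
    (fun x hx => hφ x (hsub hx)) (fun x hx => hφ' x (hsub hx)) (hcont.mono hsub)
    (fun x hx => le_trans (by positivity) (hge x (hsub hx))) (by linarith)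
  have hhead := norm_integral_cexp_I_mul_le φ hcs
  rw [← intervalIntegral.integral_add_adjacent_intervals
    ((hE.mono (Set.Icc_subset_Icc_right hd)).intervalIntegrable_of_Icc hcs)
    ((hE.mono hsub).intervalIntegrable_of_Icc hd)]
  have h2 : 2 / (2 / s) = s := by field_simp
  refine (norm_add_le _ _).trans ?_
  linarith

/-- Second-derivative van der Corput estimate when the phase is nonincreasing. -/
lemma norm_integral_cexp_le_of_deriv_nonpos {φ φ' φ'' : ℝ → ℝ} {c d s : ℝ} (hcd : c ≤ d)
    (hs : 0 < s)
    (hφ : ∀ x ∈ Set.Icc c d, HasDerivAt φ (φ' x) x)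
    (hφ' : ∀ x ∈ Set.Icc c d, HasDerivAt φ' (φ'' x) x)
    (hcont : ContinuousOn φ'' (Set.Icc c d))
    (hge : ∀ x ∈ Set.Icc c d, 2 / s ^ 2 ≤ φ'' x) (h0 : φ' d ≤ 0) :
    ‖∫ x in c..d, cexp (I * φ x)‖ ≤ 2 * s := by
  have hmem : ∀ x ∈ Set.Icc (-d) (-c), -x ∈ Set.Icc c d := fun x hx =>
    ⟨by linarith [hx.2], by linarith [hx.1]⟩
  have := norm_integral_cexp_le_of_deriv_nonneg (φ := fun x => φ (-x)) (φ' := fun x => -φ' (-x))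
    (φ'' := fun x => φ'' (-x)) (c := -d) (d := -c) (neg_le_neg hcd) hs
    (fun x hx => by
      simpa [Function.comp_def] using (hφ (-x) (hmem x hx)).comp x (hasDerivAt_neg x))
    (fun x hx => by
      exact ((hφ' (-x) (hmem x hx)).comp x (hasDerivAt_neg x)).neg.congr_deriv (by ring))
    (hcont.comp continuousOn_neg hmem) (fun x hx => hge (-x) (hmem x hx)) (by simpa using h0)
  rwa [intervalIntegral.integral_comp_neg (fun x => cexp (I * φ x)), neg_neg, neg_neg] at this

/-- Second-derivative van der Corput estimate. -/
lemma norm_integral_cexp_le_of_le_deriv2 {φ φ' φ'' : ℝ → ℝ} {c d s : ℝ} (hcd : c ≤ d)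
    (hs : 0 < s)
    (hφ : ∀ x ∈ Set.Icc c d, HasDerivAt φ (φ' x) x)
    (hφ' : ∀ x ∈ Set.Icc c d, HasDerivAt φ' (φ'' x) x)
    (hcont : ContinuousOn φ'' (Set.Icc c d))
    (hge : ∀ x ∈ Set.Icc c d, 2 / s ^ 2 ≤ φ'' x) :
    ‖∫ x in c..d, cexp (I * φ x)‖ ≤ 4 * s := by
  rcases le_total 0 (φ' c) with hc | hc
  · exact (norm_integral_cexp_le_of_deriv_nonneg hcd hs hφ hφ' hcont hge hc).trans (by linarith)
  rcases le_total (φ' d) 0 with hd | hd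
  · exact (norm_integral_cexp_le_of_deriv_nonpos hcd hs hφ hφ' hcont hge hd).trans (by linarith)
  obtain ⟨e, he, he0⟩ := intermediate_value_Icc hcd
    (fun x hx => (hφ' x hx).continuousAt.continuousWithinAt) (show (0 : ℝ) ∈ _ from ⟨hc, hd⟩)
  have hl : Set.Icc c e ⊆ Set.Icc c d := Set.Icc_subset_Icc_right he.2
  have hr : Set.Icc e d ⊆ Set.Icc c d := Set.Icc_subset_Icc_left he.1
  have hE : ContinuousOn (fun x => cexp (I * φ x)) (Set.Icc c d) := by
    have : ContinuousOn φ (Set.Icc c d) :=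
      fun x hx => (hφ x hx).continuousAt.continuousWithinAt
    fun_prop
  rw [← intervalIntegral.integral_add_adjacent_intervals
    ((hE.mono hl).intervalIntegrable_of_Icc he.1) ((hE.mono hr).intervalIntegrable_of_Icc he.2)]
  have h1 := norm_integral_cexp_le_of_deriv_nonpos he.1 hs (fun x hx => hφ x (hl hx))
    (fun x hx => hφ' x (hl hx)) (hcont.mono hl) (fun x hx => hge x (hl hx)) he0.le
  have h2 := norm_integral_cexp_le_of_deriv_nonneg he.2 hs (fun x hx => hφ x (hr hx))
    (fun x hx => hφ' x (hr hx)) (hcont.mono hr) (fun x hx => hge x (hr hx)) he0.ge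
  refine (norm_add_le _ _).trans ?_
  linarith

lemma rhoPlus_of_one_le {l : ℝ} (hl : 1 ≤ l) : rhoPlus l = (Real.sqrt (l ^ 2 - 1) : ℂ) := by
  rcases hl.eq_or_lt with rfl | hl
  · simp [rhoPlus]
  · simp [rhoPlus, hl]

/-- The integral of `exp (i (t λ² + A √(λ² - 1) + B λ))` over a subinterval of `[1, ∞)`. -/
lemma norm_integral_cexp_phase_le {a x A B s : ℝ} (ha : 1 ≤ a) (hax : a ≤ x) (hA : A ≤ 0)
    (hs : 0 < s) :
    ‖∫ l in a..x, cexp (I * ((l ^ 2 / s ^ 2 + A * Real.sqrt (l ^ 2 - 1) + B * l : ℝ) : ℂ))‖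
      ≤ 5 * s := by
  rcases le_total x (a + s) with hd | hd
  · exact (norm_integral_cexp_I_mul_le _ hax).trans (by linarith)
  have has : a ≤ a + s := by linarith
  have hpos : ∀ l ∈ Set.Icc (a + s) x, 0 < l ^ 2 - 1 := fun l hl => by nlinarith [hl.1]
  have hc : Continuous fun l : ℝ =>
      cexp (I * ((l ^ 2 / s ^ 2 + A * Real.sqrt (l ^ 2 - 1) + B * l : ℝ) : ℂ)) := by fun_prop
  rw [← intervalIntegral.integral_add_adjacent_intervals (hc.intervalIntegrable a (a + s))
    (hc.intervalIntegrable (a + s) x)]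
  have h1 := norm_integral_cexp_I_mul_le
    (fun l => l ^ 2 / s ^ 2 + A * Real.sqrt (l ^ 2 - 1) + B * l) has
  have hsqrt : ∀ l ∈ Set.Icc (a + s) x,
      HasDerivAt (fun l : ℝ => Real.sqrt (l ^ 2 - 1)) (l / Real.sqrt (l ^ 2 - 1)) l := by
    intro l hl
    refine (((hasDerivAt_pow 2 l).sub_const 1).sqrt (hpos l hl).ne').congr_deriv ?_
    field_simp
    simp [mul_comm]
  have h2 := norm_integral_cexp_le_of_le_deriv2
    (φ := fun l => l ^ 2 / s ^ 2 + A * Real.sqrt (l ^ 2 - 1) + B * l)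
    (φ' := fun l => 2 * l / s ^ 2 + A * (l / Real.sqrt (l ^ 2 - 1)) + B)
    (φ'' := fun l => 2 / s ^ 2 + (-A) / Real.sqrt (l ^ 2 - 1) ^ 3) hd hs
    (fun l hl => by
      refine ((((hasDerivAt_pow 2 l).div_const (s ^ 2)).add ((hsqrt l hl).const_mul A)).add
        ((hasDerivAt_id l).const_mul B)).congr_deriv ?_
      simp)
    (fun l hl => by
      have hr : 0 < Real.sqrt (l ^ 2 - 1) := Real.sqrt_pos.2 (hpos l hl)
      have hsq : Real.sqrt (l ^ 2 - 1) ^ 2 = l ^ 2 - 1 := Real.sq_sqrt (hpos l hl).le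
      refine ((((hasDerivAt_id l).const_mul 2).div_const (s ^ 2)).add
        (((hasDerivAt_id l).div (hsqrt l hl) hr.ne').const_mul A)).add_const B |>.congr_deriv ?_
      simp only [id]
      generalize Real.sqrt (l ^ 2 - 1) = r at hr hsq
      field_simp
      linear_combination (A * s ^ 2) * hsq)
    (by
      refine continuousOn_const.add (ContinuousOn.div continuousOn_const (by fun_prop) ?_)
      exact fun l hl => (pow_pos (Real.sqrt_pos.2 (hpos l hl)) 3).ne')
    (fun l hl => by
      have : 0 ≤ (-A) / Real.sqrt (l ^ 2 - 1) ^ 3 := div_nonneg (by linarith) (by positivity)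
      linarith)
  refine (norm_add_le _ _).trans ?_
  linarith

/-- If all the primitives of a continuous `f` on `[a, b]` are bounded by `K`, then
`∫ f h` is bounded by `K` times `‖h b‖ + ∫ ‖h'‖`. -/
lemma norm_integral_mul_le_of_primitive_le {f h h' : ℝ → ℂ} {a b K : ℝ} (hab : a ≤ b)
    (hf : Continuous f) (hK : ∀ x ∈ Set.Icc a b, ‖∫ l in a..x, f l‖ ≤ K)
    (hderiv : ∀ l ∈ Set.Icc a b, HasDerivWithinAt h (h' l) (Set.Icc a b) l)
    (hcont : ContinuousOn h' (Set.Icc a b)) :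
    ‖∫ l in a..b, f l * h l‖ ≤ K * (‖h b‖ + ∫ l in a..b, ‖h' l‖) := by
  have hparts := intervalIntegral.integral_deriv_mul_eq_sub_of_hasDerivWithinAt
    (a := a) (b := b) (u := fun x => ∫ l in a..x, f l) (u' := f) (v := h) (v' := h')
    (fun x _ => (hf.integral_hasStrictDerivAt a x).hasDerivAt.hasDerivWithinAt)
    (by rwa [Set.uIcc_of_le hab]) (hf.intervalIntegrable a b)
    (hcont.intervalIntegrable_of_Icc hab)
  have hF : Continuous fun x => ∫ l in a..x, f l :=
    intervalIntegral.continuous_primitive (fun _ _ => hf.intervalIntegrable _ _) a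
  have hh : ContinuousOn h (Set.Icc a b) := fun x hx => (hderiv x hx).continuousWithinAt
  rw [intervalIntegral.integral_add (f := fun x => f x * h x)
    (g := fun x => (∫ l in a..x, f l) * h' x) ((hf.continuousOn.mul hh).intervalIntegrable_of_Icc hab)
    ((hF.continuousOn.mul hcont).intervalIntegrable_of_Icc hab)] at hparts
  rw [eq_sub_of_add_eq hparts, intervalIntegral.integral_same, zero_mul, sub_zero, mul_add,
    ← intervalIntegral.integral_const_mul]
  refine (norm_sub_le _ _).trans (add_le_add ?_ ?_)
  · rw [norm_mul]
    exact mul_le_mul_of_nonneg_right (hK b (Set.right_mem_Icc.2 hab)) (norm_nonneg _)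
  · refine intervalIntegral.norm_integral_le_of_norm_le hab
      (Filter.Eventually.of_forall fun x hx => ?_)
      ((continuousOn_const.mul hcont.norm).intervalIntegrable_of_Icc hab)
    rw [norm_mul]
    exact mul_le_mul_of_nonneg_right (hK x (Set.Ioc_subset_Icc_self hx)) (norm_nonneg _)

/-- Van der Corput type estimate:
`|∫_a^b e^{itλ²} e^{iρ₊(λ)A} e^{iλB} h(λ) dλ| ≤ 30 (sup|h| + ∫|h'|) t^{−1/2}`. -/
theorem stmt9 (a b A B t : ℝ) (ha : 1 ≤ a) (hab : a < b) (hA : A ≤ 0) (ht : 0 < t)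
    (h h' : ℝ → ℂ)
    (hderiv : ∀ l ∈ Set.Icc a b, HasDerivWithinAt h (h' l) (Set.Icc a b) l)
    (hcont : ContinuousOn h' (Set.Icc a b)) :
    ‖∫ l in Set.Icc a b,
        Complex.exp (Complex.I * (t : ℂ) * (l : ℂ) ^ 2)
          * Complex.exp (Complex.I * rhoPlus l * (A : ℂ))
          * Complex.exp (Complex.I * (l : ℂ) * (B : ℂ)) * h l‖
      ≤ 30 * ((⨆ l : Set.Icc a b, ‖h l‖) + ∫ l in Set.Icc a b, ‖h' l‖) * t ^ (-(1:ℝ)/2) := by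
  have hs : 0 < t ^ (-(1 : ℝ) / 2) := Real.rpow_pos_of_pos ht _
  have hs2 : (t ^ (-(1 : ℝ) / 2)) ^ 2 = t⁻¹ := by
    rw [← Real.rpow_natCast, ← Real.rpow_mul ht.le, ← Real.rpow_neg_one]
    norm_num
  generalize t ^ (-(1 : ℝ) / 2) = s at hs hs2
  have hintegrand : ∀ l ∈ Set.Icc a b,
      cexp (I * (t : ℂ) * (l : ℂ) ^ 2) * cexp (I * rhoPlus l * (A : ℂ))
          * cexp (I * (l : ℂ) * (B : ℂ)) * h l
        = cexp (I * ((l ^ 2 / s ^ 2 + A * Real.sqrt (l ^ 2 - 1) + B * l : ℝ) : ℂ)) * h l := by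
    intro l hl
    rw [rhoPlus_of_one_le (ha.trans hl.1), ← Complex.exp_add, ← Complex.exp_add, hs2]
    congr 2
    push_cast
    rw [div_inv_eq_mul]
    ring
  have hh : ContinuousOn h (Set.Icc a b) := fun x hx => (hderiv x hx).continuousWithinAt
  have hbdd : BddAbove (Set.range fun l : Set.Icc a b => ‖h l‖) := by
    have := isCompact_Icc.bddAbove_image hh.norm
    rwa [Set.image_eq_range] at this
  have hsup : ‖h b‖ ≤ ⨆ l : Set.Icc a b, ‖h l‖ :=
    le_ciSup hbdd ⟨b, Set.right_mem_Icc.2 hab.le⟩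
  have hint : 0 ≤ ∫ l in a..b, ‖h' l‖ :=
    intervalIntegral.integral_nonneg hab.le fun _ _ => norm_nonneg _
  have hmain := norm_integral_mul_le_of_primitive_le hab.le
    (f := fun l : ℝ =>
      cexp (I * ((l ^ 2 / s ^ 2 + A * Real.sqrt (l ^ 2 - 1) + B * l : ℝ) : ℂ)))
    (by fun_prop) (fun x hx => norm_integral_cexp_phase_le ha hx.1 hA hs) hderiv hcont
  rw [setIntegral_congr_fun measurableSet_Icc hintegrand, integral_Icc_eq_integral_Ioc,
    integral_Icc_eq_integral_Ioc, ← intervalIntegral.integral_of_le hab.le,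
    ← intervalIntegral.integral_of_le hab.le]
  refine hmain.trans ?_
  have hnn : 0 ≤ (⨆ l : Set.Icc a b, ‖h l‖) + ∫ l in a..b, ‖h' l‖ := by
    linarith [norm_nonneg (h b)]
  calc 5 * s * (‖h b‖ + ∫ l in a..b, ‖h' l‖)
      ≤ 5 * s * ((⨆ l : Set.Icc a b, ‖h l‖) + ∫ l in a..b, ‖h' l‖) := by gcongr
    _ ≤ 30 * ((⨆ l : Set.Icc a b, ‖h l‖) + ∫ l in a..b, ‖h' l‖) * s := by
        nlinarith [mul_nonneg hnn hs.le]
end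

section
/- Let a < b ≤ 1, A ≥ 0, B ∈ ℝ, and let h ∈ C¹([a,b]) be complex valued. Then for all t > 0, |∫_a^b e^{itλ²} e^{iρ₊(λ)A} e^{iλB} h(λ) dλ| ≤ 30 (sup_{[a,b]}|h| + ∫_a^b |h'(λ)| dλ) t^{−1/2}. -/
open MeasureTheory Complex

theorem hasDerivWithinAt_integral_Icc {E : Type*} [NormedAddCommGroup E] [NormedSpace ℝ E]
    [CompleteSpace E] {f : ℝ → E} {α β x : ℝ} (hf : ContinuousOn f (Set.Icc α β))
    (hx : x ∈ Set.Icc α β) :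
    HasDerivWithinAt (fun u => ∫ l in α..u, f l) (f x) (Set.Icc α β) x := by
  have : Fact (x ∈ Set.Icc α β) := ⟨hx⟩
  have hsub : Set.uIcc α x ⊆ Set.Icc α β := by
    rw [Set.uIcc_of_le hx.1]
    exact Set.Icc_subset_Icc_right hx.2
  exact intervalIntegral.integral_hasDerivWithinAt_right (hf.mono hsub).intervalIntegrable
    (hf.stronglyMeasurableAtFilter_nhdsWithin measurableSet_Icc x) (hf x hx)

theorem norm_sub_le_of_norm_derivWithin_le {E : Type*} [NormedAddCommGroup E] [NormedSpace ℝ E]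
    {D D' : ℝ → E} {R R' : ℝ → ℝ} {α β : ℝ} (hαβ : α ≤ β)
    (hD : ∀ x ∈ Set.Icc α β, HasDerivWithinAt D (D' x) (Set.Icc α β) x)
    (hR : ∀ x ∈ Set.Icc α β, HasDerivWithinAt R (R' x) (Set.Icc α β) x)
    (bound : ∀ x ∈ Set.Icc α β, ‖D' x‖ ≤ R' x) : ‖D β - D α‖ ≤ R β - R α := by
  refine image_norm_le_of_norm_deriv_right_le_deriv_boundary' (f := fun x => D x - D α)
    (B := fun x => R x - R α) (f' := D') (B' := R') (a := α) (b := β)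
    (fun x hx => ((hD x hx).sub_const _).continuousWithinAt) (fun x hx => ?_) (by simp)
    (fun x hx => ((hR x hx).sub_const _).continuousWithinAt) (fun x hx => ?_)
    (fun x hx => bound x (Set.Ico_subset_Icc_self hx)) (Set.right_mem_Icc.2 hαβ)
  · exact ((hD x (Set.Ico_subset_Icc_self hx)).sub_const _).mono_of_mem_nhdsWithin
      (Icc_mem_nhdsGE_of_mem hx)
  · exact ((hR x (Set.Ico_subset_Icc_self hx)).sub_const _).mono_of_mem_nhdsWithin
      (Icc_mem_nhdsGE_of_mem hx)

theorem norm_div_sq_add_sq_le {r : ℝ} (hr : 0 < r) (p : ℝ) :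
    ‖-(I * (p : ℂ)) / ((p ^ 2 + r ^ 2 : ℝ) : ℂ)‖ ≤ 1 / (2 * r) := by
  have hq : 0 < p ^ 2 + r ^ 2 := by positivity
  rw [norm_div, norm_neg, norm_mul, norm_I, one_mul, norm_real, norm_real, Real.norm_eq_abs,
    Real.norm_eq_abs, abs_of_pos hq, div_le_div_iff₀ hq (by positivity), ← sq_abs p]
  nlinarith [sq_nonneg (|p| - r)]

theorem norm_one_sub_deriv_le {r p p' : ℝ} (hr : 0 < r) (hp : r ^ 2 ≤ p') :
    ‖(1 : ℂ) - (-(I * (p' : ℂ)) * ((r ^ 2 - p ^ 2 : ℝ) : ℂ) / ((p ^ 2 + r ^ 2 : ℝ) : ℂ) ^ 2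
      + -(I * (p : ℂ)) / ((p ^ 2 + r ^ 2 : ℝ) : ℂ) * (I * (p : ℂ)))‖
      ≤ 2 * p' / (p ^ 2 + r ^ 2) := by
  have hq : 0 < p ^ 2 + r ^ 2 := by positivity
  have hqc : ((p ^ 2 + r ^ 2 : ℝ) : ℂ) ≠ 0 := by exact_mod_cast hq.ne'
  have hp' : 0 < p' := lt_of_lt_of_le (by positivity) hp
  have e : (1 : ℂ) - (-(I * (p' : ℂ)) * ((r ^ 2 - p ^ 2 : ℝ) : ℂ) / ((p ^ 2 + r ^ 2 : ℝ) : ℂ) ^ 2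
      + -(I * (p : ℂ)) / ((p ^ 2 + r ^ 2 : ℝ) : ℂ) * (I * (p : ℂ)))
      = ((r ^ 2 / (p ^ 2 + r ^ 2) : ℝ) : ℂ)
        + I * ((p' * (r ^ 2 - p ^ 2) / (p ^ 2 + r ^ 2) ^ 2 : ℝ) : ℂ) := by
    push_cast at hqc ⊢
    field_simp
    linear_combination ((p : ℂ) ^ 2 * (p ^ 2 + r ^ 2)) * I_sq
  rw [e]
  refine (norm_add_le _ _).trans ?_
  rw [norm_mul, norm_I, one_mul, norm_real, norm_real, Real.norm_eq_abs, Real.norm_eq_abs,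
    abs_of_nonneg (by positivity : 0 ≤ r ^ 2 / (p ^ 2 + r ^ 2)), abs_div, abs_mul,
    abs_of_pos hp', abs_of_pos (by positivity : 0 < (p ^ 2 + r ^ 2) ^ 2)]
  have h1 : |r ^ 2 - p ^ 2| ≤ p ^ 2 + r ^ 2 := by
    rw [abs_le]; constructor <;> nlinarith [sq_nonneg p, sq_nonneg r]
  have h2 : p' * |r ^ 2 - p ^ 2| / (p ^ 2 + r ^ 2) ^ 2 ≤ p' / (p ^ 2 + r ^ 2) := by
    rw [div_le_div_iff₀ (by positivity) hq]
    nlinarith [mul_le_mul_of_nonneg_left h1 (mul_pos hp' hq).le]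
  have h3 : r ^ 2 / (p ^ 2 + r ^ 2) ≤ p' / (p ^ 2 + r ^ 2) := by gcongr
  calc _ ≤ p' / (p ^ 2 + r ^ 2) + p' / (p ^ 2 + r ^ 2) := add_le_add h3 h2
    _ = _ := by ring

/-- Second-derivative van der Corput estimate for an amplitude `k` whose derivative is dominated
by that of `V`. -/
theorem norm_integral_exp_mul_le {α β r M : ℝ} (hαβ : α ≤ β) (hr : 0 < r)
    {φ φ' φ'' V v : ℝ → ℝ} {k k' : ℝ → ℂ}
    (hφ : ∀ x ∈ Set.Icc α β, HasDerivWithinAt φ (φ' x) (Set.Icc α β) x)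
    (hφ' : ∀ x ∈ Set.Icc α β, HasDerivWithinAt φ' (φ'' x) (Set.Icc α β) x)
    (hφ'' : ∀ x ∈ Set.Icc α β, r ^ 2 ≤ φ'' x)
    (hk : ∀ x ∈ Set.Icc α β, HasDerivWithinAt k (k' x) (Set.Icc α β) x)
    (hV : ∀ x ∈ Set.Icc α β, HasDerivWithinAt V (v x) (Set.Icc α β) x)
    (hM : ∀ x ∈ Set.Icc α β, ‖k x‖ ≤ M) (hkv : ∀ x ∈ Set.Icc α β, ‖k' x‖ ≤ v x) :
    ‖∫ x in α..β, Complex.exp (I * φ x) * k x‖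
      ≤ ((1 + 2 * Real.pi) * M + (V β - V α) / 2) / r := by
  set s := Set.Icc α β
  have hα : α ∈ s := Set.left_mem_Icc.2 hαβ
  have hβ : β ∈ s := Set.right_mem_Icc.2 hαβ
  have hM0 : 0 ≤ M := (norm_nonneg _).trans (hM α hα)
  set ψ : ℝ → ℂ := fun x => -(I * (φ' x : ℂ)) / ((φ' x ^ 2 + r ^ 2 : ℝ) : ℂ) with hψ
  set ψ' : ℝ → ℂ := fun x => -(I * (φ'' x : ℂ)) * ((r ^ 2 - φ' x ^ 2 : ℝ) : ℂ)
    / ((φ' x ^ 2 + r ^ 2 : ℝ) : ℂ) ^ 2 with hψ'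
  have dE : ∀ x ∈ s, HasDerivWithinAt (fun x => Complex.exp (I * φ x))
      (Complex.exp (I * φ x) * (I * φ' x)) s x := fun x hx =>
    ((hφ x hx).ofReal_comp.const_mul I).cexp
  have dψ : ∀ x ∈ s, HasDerivWithinAt ψ (ψ' x) s x := by
    intro x hx
    have hq : ((φ' x ^ 2 + r ^ 2 : ℝ) : ℂ) ≠ 0 := by
      have : 0 < φ' x ^ 2 + r ^ 2 := by positivity
      exact_mod_cast this.ne'
    have h1 := ((hφ' x hx).ofReal_comp.const_mul I).neg
    have h2 := (((hφ' x hx).pow 2).add_const (r ^ 2)).ofReal_comp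
    refine (h1.div h2 hq).congr_deriv ?_
    simp only [hψ']
    congr 1
    push_cast
    simp
    ring
  have dW : ∀ x ∈ s, HasDerivWithinAt (fun x => ψ x * Complex.exp (I * φ x) * k x)
      ((ψ' x * Complex.exp (I * φ x) + ψ x * (Complex.exp (I * φ x) * (I * φ' x))) * k x
        + ψ x * Complex.exp (I * φ x) * k' x) s x := fun x hx =>
    ((dψ x hx).mul (dE x hx)).mul (hk x hx)
  have hfc : ContinuousOn (fun x => Complex.exp (I * φ x) * k x) s := fun x hx =>
    (dE x hx).continuousWithinAt.mul (hk x hx).continuousWithinAt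
  have dG : ∀ x ∈ s, HasDerivWithinAt (fun u => ∫ l in α..u, Complex.exp (I * φ l) * k l)
      (Complex.exp (I * φ x) * k x) s x := fun x hx => hasDerivWithinAt_integral_Icc hfc hx
  have dR : ∀ x ∈ s, HasDerivWithinAt
      (fun x => 2 * M / r * Real.arctan (φ' x / r) + 1 / (2 * r) * V x)
      (2 * φ'' x / (φ' x ^ 2 + r ^ 2) * M + 1 / (2 * r) * v x) s x := by
    intro x hx
    have h1 := (((Real.hasDerivAt_arctan (φ' x / r)).comp_hasDerivWithinAt x
      ((hφ' x hx).div_const r)).const_mul (2 * M / r)).add ((hV x hx).const_mul (1 / (2 * r)))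
    refine h1.congr_deriv ?_
    have hq : φ' x ^ 2 + r ^ 2 ≠ 0 := by positivity
    have hq' : 1 + (φ' x / r) ^ 2 ≠ 0 := by positivity
    congr 1
    field_simp
    ring
  have nE : ∀ x, ‖Complex.exp (I * φ x)‖ = 1 := fun x => by rw [mul_comm]; exact norm_exp_ofReal_mul_I _
  have nψ : ∀ x, ‖ψ x‖ ≤ 1 / (2 * r) := fun x => norm_div_sq_add_sq_le hr _
  have nW : ∀ x ∈ s, ‖ψ x * Complex.exp (I * φ x) * k x‖ ≤ 1 / (2 * r) * M := by
    intro x hx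
    rw [norm_mul, norm_mul, nE, mul_one]
    exact mul_le_mul (nψ x) (hM x hx) (norm_nonneg _) (by positivity)
  have key := norm_sub_le_of_norm_derivWithin_le hαβ (fun x hx => (dG x hx).sub (dW x hx)) dR ?_
  · have a1 := Real.arctan_lt_pi_div_two (φ' β / r)
    have a2 := Real.neg_pi_div_two_lt_arctan (φ' α / r)
    simp only [Pi.sub_apply, intervalIntegral.integral_same, zero_sub, sub_neg_eq_add] at key
    have e : (∫ x in α..β, Complex.exp (I * φ x) * k x)
        = ((∫ x in α..β, Complex.exp (I * φ x) * k x) - ψ β * Complex.exp (I * φ β) * k β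
          + ψ α * Complex.exp (I * φ α) * k α) + ψ β * Complex.exp (I * φ β) * k β
          - ψ α * Complex.exp (I * φ α) * k α := by ring
    rw [e]
    refine (norm_sub_le _ _).trans ((add_le_add (norm_add_le _ _) le_rfl).trans
      ((add_le_add (add_le_add key (nW β hβ)) (nW α hα)).trans ?_))
    have h3 : 2 * M / r * (Real.arctan (φ' β / r) - Real.arctan (φ' α / r))
        ≤ 2 * M / r * Real.pi := by
      apply mul_le_mul_of_nonneg_left _ (by positivity)
      linarith
    have e2 : ((1 + 2 * Real.pi) * M + (V β - V α) / 2) / r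
        = 2 * M / r * Real.pi + 1 / (2 * r) * V β - 1 / (2 * r) * V α + 1 / (2 * r) * M
          + 1 / (2 * r) * M := by
      field_simp; ring
    rw [e2]
    linarith
  · intro x hx
    have e : Complex.exp (I * φ x) * k x - ((ψ' x * Complex.exp (I * φ x)
        + ψ x * (Complex.exp (I * φ x) * (I * φ' x))) * k x + ψ x * Complex.exp (I * φ x) * k' x)
        = (1 - (ψ' x + ψ x * (I * φ' x))) * Complex.exp (I * φ x) * k x
          - ψ x * Complex.exp (I * φ x) * k' x := by ring
    rw [e]
    refine (norm_sub_le _ _).trans (add_le_add ?_ ?_)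
    · rw [norm_mul, norm_mul, nE, mul_one]
      have hp := hφ'' x hx
      have : 0 ≤ φ'' x := (sq_nonneg r).trans hp
      exact mul_le_mul (norm_one_sub_deriv_le hr hp) (hM x hx) (norm_nonneg _) (by positivity)
    · rw [norm_mul, norm_mul, nE, mul_one]
      exact mul_le_mul (nψ x) (hkv x hx) (norm_nonneg _) (by positivity)

theorem norm_integral_le_of_forall_Ioo {E : Type*} [NormedAddCommGroup E] [NormedSpace ℝ E]
    [CompleteSpace E] {F : ℝ → E} {α β K : ℝ} (hαβ : α ≤ β) (hK : 0 ≤ K)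
    (hF : ContinuousOn F (Set.Icc α β))
    (hFK : ∀ c d, α < c → c ≤ d → d < β → ‖∫ x in c..d, F x‖ ≤ K) :
    ‖∫ x in α..β, F x‖ ≤ K := by
  rcases hαβ.eq_or_lt with rfl | hlt
  · simpa using hK
  have hFi : ∀ c ∈ Set.Icc α β, ∀ d ∈ Set.Icc α β, IntervalIntegrable F volume c d :=
    fun c hc d hd => (hF.mono (Set.uIcc_subset_Icc hc hd)).intervalIntegrable
  have hα : α ∈ Set.Icc α β := Set.left_mem_Icc.2 hαβ
  have hβ : β ∈ Set.Icc α β := Set.right_mem_Icc.2 hαβ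
  set P : ℝ → E := fun x => ∫ l in α..x, F l
  have hPc : ∀ x ∈ Set.Icc α β, ContinuousWithinAt P (Set.Icc α β) x := fun x hx =>
    (hasDerivWithinAt_integral_Icc hF hx).continuousWithinAt
  have hsub : ∀ c ∈ Set.Icc α β, ∀ d ∈ Set.Icc α β, ∫ x in c..d, F x = P d - P c :=
    fun c hc d hd =>
      (intervalIntegral.integral_interval_sub_left (hFi α hα d hd) (hFi α hα c hc)).symm
  have step : ∀ c, α < c → c < β → ‖P β - P c‖ ≤ K := by
    intro c hc hcβ
    have : (nhdsWithin β (Set.Ioo c β)).NeBot := right_nhdsWithin_Ioo_neBot hcβ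
    refine le_of_tendsto (((hPc β hβ).mono
      (fun x hx => ⟨hc.le.trans hx.1.le, hx.2.le⟩)).tendsto.sub_const (P c)).norm
      (Filter.eventually_of_mem self_mem_nhdsWithin fun d (hd : d ∈ Set.Ioo c β) => ?_)
    rw [← hsub c ⟨hc.le, hcβ.le⟩ d ⟨hc.le.trans hd.1.le, hd.2.le⟩]
    exact hFK c d hc hd.1.le hd.2
  rw [hsub α hα β hβ]
  have : (nhdsWithin α (Set.Ioo α β)).NeBot := left_nhdsWithin_Ioo_neBot hlt
  exact le_of_tendsto (((hPc α hα).mono Set.Ioo_subset_Icc_self).tendsto.const_sub (P β)).norm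
    (Filter.eventually_of_mem self_mem_nhdsWithin fun c (hc : c ∈ Set.Ioo α β) =>
      step c hc.1 hc.2)

/-- Second-derivative van der Corput estimate with a monotone real factor `s`, the smoothness of
the phase and of `s` being required only in the interior. -/
theorem norm_integral_exp_mul_monotone_mul_le {a b α β r M σ : ℝ} (haα : a ≤ α) (hαβ : α ≤ β)
    (hβb : β ≤ b) (hr : 0 < r) {φ φ' φ'' s s' : ℝ → ℝ} {h h' : ℝ → ℂ}
    (hφc : ContinuousOn φ (Set.Icc α β)) (hsc : ContinuousOn s (Set.Icc α β))
    (hφ : ∀ x ∈ Set.Ioo α β, HasDerivAt φ (φ' x) x)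
    (hφ' : ∀ x ∈ Set.Ioo α β, HasDerivAt φ' (φ'' x) x)
    (hφ'' : ∀ x ∈ Set.Ioo α β, r ^ 2 ≤ φ'' x)
    (hs : ∀ x ∈ Set.Ioo α β, HasDerivAt s (s' x) x)
    (hs0 : ∀ x, 0 ≤ s x) (hs1 : ∀ x, s x ≤ 1)
    (hσ : |σ| = 1) (hσs : ∀ x ∈ Set.Ioo α β, 0 ≤ σ * s' x)
    (hh : ∀ x ∈ Set.Icc a b, HasDerivWithinAt h (h' x) (Set.Icc a b) x)
    (hh' : ContinuousOn h' (Set.Icc a b)) (hM : ∀ x ∈ Set.Icc a b, ‖h x‖ ≤ M) :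
    ‖∫ x in α..β, Complex.exp (I * φ x) * (s x * h x)‖
      ≤ 8 * (M + ∫ x in a..b, ‖h' x‖) / r := by
  have hsub : Set.Icc α β ⊆ Set.Icc a b := Set.Icc_subset_Icc haα hβb
  have hM0 : 0 ≤ M := (norm_nonneg _).trans (hM α ⟨haα, hαβ.trans hβb⟩)
  have hI : ∀ x, a ≤ x → 0 ≤ ∫ x in a..x, ‖h' x‖ := fun x hx =>
    intervalIntegral.integral_nonneg hx fun _ _ => norm_nonneg _
  have hI0 := hI b (haα.trans (hαβ.trans hβb))
  have hhc : ContinuousOn h (Set.Icc α β) := fun x hx =>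
    ((hh x (hsub hx)).mono hsub).continuousWithinAt
  refine norm_integral_le_of_forall_Ioo hαβ (by positivity)
    ((continuous_exp.comp_continuousOn
      ((continuous_ofReal.comp_continuousOn hφc).const_mul I)).mul
      ((continuous_ofReal.comp_continuousOn hsc).mul hhc)) fun c d hc hcd hd => ?_
  have hcd' : Set.Icc c d ⊆ Set.Ioo α β := fun x hx => ⟨hc.trans_le hx.1, hx.2.trans_lt hd⟩
  have hcd'' : Set.Icc c d ⊆ Set.Icc a b := hcd'.trans (Set.Ioo_subset_Icc_self.trans hsub)
  have key := norm_integral_exp_mul_le (M := M) (k := fun x => (s x : ℂ) * h x)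
    (k' := fun x => (s' x : ℂ) * h x + s x * h' x)
    (V := fun x => M * (σ * s x) + ∫ l in a..x, ‖h' l‖)
    (v := fun x => M * (σ * s' x) + ‖h' x‖) hcd hr
    (fun x hx => (hφ x (hcd' hx)).hasDerivWithinAt)
    (fun x hx => (hφ' x (hcd' hx)).hasDerivWithinAt)
    (fun x hx => hφ'' x (hcd' hx))
    (fun x hx => (hs x (hcd' hx)).hasDerivWithinAt.ofReal_comp.mul
      ((hh x (hcd'' hx)).mono hcd''))
    (fun x hx => (((hs x (hcd' hx)).hasDerivWithinAt.const_mul σ).const_mul M).add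
      ((hasDerivWithinAt_integral_Icc hh'.norm (hcd'' hx)).mono hcd''))
    (fun x hx => ?_) (fun x hx => ?_)
  · refine key.trans ?_
    gcongr
    have h1 : (∫ x in a..d, ‖h' x‖) ≤ ∫ x in a..b, ‖h' x‖ := by
      refine intervalIntegral.integral_mono_interval le_rfl (haα.trans (hc.le.trans hcd))
        (hd.le.trans hβb) (Filter.Eventually.of_forall fun _ => norm_nonneg _) ?_
      refine ContinuousOn.intervalIntegrable ?_
      rw [Set.uIcc_of_le (haα.trans (hαβ.trans hβb))]
      exact hh'.norm
    have h2 := hI c (haα.trans hc.le)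
    have h3 : σ * s d - σ * s c ≤ 1 := by
      have hd1 := hs1 d; have hd0 := hs0 d; have hc1 := hs1 c; have hc0 := hs0 c
      rcases (abs_eq zero_le_one).1 hσ with rfl | rfl <;> linarith
    have h4 : M * (σ * s d) - M * (σ * s c) ≤ M := by
      rw [← mul_sub]; exact mul_le_of_le_one_right hM0 h3
    have h5 := mul_le_mul_of_nonneg_right Real.pi_lt_d2.le hM0
    linarith
  · rw [norm_mul, norm_real, Real.norm_eq_abs, abs_of_nonneg (hs0 x)]
    exact (mul_le_of_le_one_left (norm_nonneg _) (hs1 x)).trans (hM x (hcd'' hx))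
  · refine (norm_add_le _ _).trans (add_le_add ?_ ?_)
    · rw [norm_mul, norm_real, Real.norm_eq_abs, mul_comm]
      have : |s' x| = σ * s' x := by
        rw [← abs_of_nonneg (hσs x (hcd' hx)), abs_mul, hσ, one_mul]
      rw [this]
      exact mul_le_mul_of_nonneg_right (hM x (hcd'' hx)) (hσs x (hcd' hx))
    · rw [norm_mul, norm_real, Real.norm_eq_abs, abs_of_nonneg (hs0 x)]
      exact mul_le_of_le_one_left (norm_nonneg _) (hs1 x)

theorem rhoPlus_of_le_one {l : ℝ} (hl : l ≤ 1) :
    rhoPlus l = I * (Real.sqrt (1 - l ^ 2) : ℂ) - (Real.sqrt (l ^ 2 - 1) : ℂ) := by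
  rw [rhoPlus, if_neg hl.not_gt]
  split_ifs with h
  · rw [Real.sqrt_eq_zero_of_nonpos (x := 1 - l ^ 2) (by nlinarith)]
    simp
  · rw [Real.sqrt_eq_zero_of_nonpos (x := l ^ 2 - 1) (by nlinarith)]
    simp

theorem hasDerivAt_sqrt_sq_sub_one {l : ℝ} (hl : l ^ 2 ≠ 1) :
    HasDerivAt (fun x => Real.sqrt (x ^ 2 - 1)) (l / Real.sqrt (l ^ 2 - 1)) l := by
  refine (((hasDerivAt_pow 2 l).sub_const 1).sqrt (sub_ne_zero.2 hl)).congr_deriv ?_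
  norm_num
  rw [mul_div_mul_left _ _ two_ne_zero]

theorem hasDerivAt_sqrt_one_sub_sq {l : ℝ} (hl : l ^ 2 ≠ 1) :
    HasDerivAt (fun x => Real.sqrt (1 - x ^ 2)) (-(l / Real.sqrt (1 - l ^ 2))) l := by
  refine (((hasDerivAt_pow 2 l).const_sub 1).sqrt (sub_ne_zero.2 hl.symm)).congr_deriv ?_
  norm_num
  rw [neg_div, mul_div_mul_left _ _ two_ne_zero]

theorem hasDerivAt_div_sqrt_sq_sub_one {l : ℝ} (hl : l ^ 2 ≠ 1) :
    HasDerivAt (fun x => x / Real.sqrt (x ^ 2 - 1)) (-(1 / Real.sqrt (l ^ 2 - 1) ^ 3)) l := by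
  rcases lt_or_gt_of_ne hl with h | h
  · have h0 : Real.sqrt (l ^ 2 - 1) = 0 := Real.sqrt_eq_zero_of_nonpos (by linarith)
    rw [h0]
    have hev : ∀ᶠ x in nhds l, x / Real.sqrt (x ^ 2 - 1) = 0 := by
      filter_upwards [(continuous_pow 2).continuousAt.eventually_lt_const h] with x hx
      rw [Real.sqrt_eq_zero_of_nonpos (by linarith), div_zero]
    simpa using (hasDerivAt_const l (0 : ℝ)).congr_of_eventuallyEq hev
  · have hpos : 0 < Real.sqrt (l ^ 2 - 1) := Real.sqrt_pos.2 (by linarith)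
    refine ((hasDerivAt_id l).div (hasDerivAt_sqrt_sq_sub_one hl) hpos.ne').congr_deriv ?_
    have hsq : Real.sqrt (l ^ 2 - 1) ^ 2 = l ^ 2 - 1 := Real.sq_sqrt (by linarith)
    simp only [id]
    field_simp
    linarith

theorem exp_mul_exp_rhoPlus_mul_exp {l : ℝ} (hl : l ≤ 1) (A B t : ℝ) :
    Complex.exp (I * (t : ℂ) * (l : ℂ) ^ 2) * Complex.exp (I * rhoPlus l * (A : ℂ))
      * Complex.exp (I * (l : ℂ) * (B : ℂ))
      = Complex.exp (I * ((t * l ^ 2 + B * l - A * Real.sqrt (l ^ 2 - 1) : ℝ) : ℂ))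
        * ((Real.exp (-(A * Real.sqrt (1 - l ^ 2))) : ℝ) : ℂ) := by
  rw [rhoPlus_of_le_one hl, ofReal_exp, ← Complex.exp_add, ← Complex.exp_add, ← Complex.exp_add]
  congr 1
  push_cast
  linear_combination (A * (Real.sqrt (1 - l ^ 2) : ℂ)) * I_sq

theorem norm_integral_piece_le {a b α β A B t M σ : ℝ} (haα : a ≤ α) (hαβ : α ≤ β)
    (hβb : β ≤ b) (hA : 0 ≤ A) (ht : 0 < t) (hσ : |σ| = 1)
    (hαβ1 : ∀ x ∈ Set.Ioo α β, x ^ 2 ≠ 1) (hσx : ∀ x ∈ Set.Ioo α β, 0 ≤ σ * x)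
    {h h' : ℝ → ℂ}
    (hh : ∀ x ∈ Set.Icc a b, HasDerivWithinAt h (h' x) (Set.Icc a b) x)
    (hh' : ContinuousOn h' (Set.Icc a b)) (hM : ∀ x ∈ Set.Icc a b, ‖h x‖ ≤ M) :
    ‖∫ l in α..β, Complex.exp (I * ((t * l ^ 2 + B * l - A * Real.sqrt (l ^ 2 - 1) : ℝ) : ℂ))
        * (((Real.exp (-(A * Real.sqrt (1 - l ^ 2))) : ℝ) : ℂ) * h l)‖
      ≤ 8 * (M + ∫ x in a..b, ‖h' x‖) / Real.sqrt (2 * t) := by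
  refine norm_integral_exp_mul_monotone_mul_le (σ := σ)
    (φ := fun l => t * l ^ 2 + B * l - A * Real.sqrt (l ^ 2 - 1))
    (φ' := fun l => 2 * t * l + B - A * (l / Real.sqrt (l ^ 2 - 1)))
    (φ'' := fun l => 2 * t + A * (1 / Real.sqrt (l ^ 2 - 1) ^ 3))
    (s := fun l => Real.exp (-(A * Real.sqrt (1 - l ^ 2))))
    (s' := fun l => Real.exp (-(A * Real.sqrt (1 - l ^ 2))) * (A * (l / Real.sqrt (1 - l ^ 2))))
    haα hαβ hβb (by positivity) (by fun_prop) (by fun_prop) (fun x hx => ?_) (fun x hx => ?_)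
    (fun x hx => ?_) (fun x hx => ?_) (fun x => (Real.exp_pos _).le) (fun x => ?_) hσ
    (fun x hx => ?_) hh hh' hM
  · refine ((((hasDerivAt_pow 2 x).const_mul t).add ((hasDerivAt_id x).const_mul B)).sub
      ((hasDerivAt_sqrt_sq_sub_one (hαβ1 x hx)).const_mul A)).congr_deriv ?_
    norm_num
    ring
  · refine ((((hasDerivAt_id x).const_mul (2 * t)).add_const B).sub
      ((hasDerivAt_div_sqrt_sq_sub_one (hαβ1 x hx)).const_mul A)).congr_deriv ?_
    ring
  · rw [Real.sq_sqrt (by positivity)]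
    exact le_add_of_nonneg_right (by positivity)
  · refine ((hasDerivAt_sqrt_one_sub_sq (hαβ1 x hx)).const_mul A).neg.exp.congr_deriv ?_
    simp only [Pi.neg_apply]
    ring
  · exact Real.exp_le_one_iff.2 (neg_nonpos.2 (by positivity))
  · have e : σ * (Real.exp (-(A * Real.sqrt (1 - x ^ 2))) * (A * (x / Real.sqrt (1 - x ^ 2))))
        = Real.exp (-(A * Real.sqrt (1 - x ^ 2))) * (A * ((σ * x) / Real.sqrt (1 - x ^ 2))) := by
      ring
    have := hσx x hx
    simp only [e]
    positivity

/-- Van der Corput type estimate: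
`|∫_a^b e^{itλ²} e^{iρ₊(λ)A} e^{iλB} h(λ) dλ| ≤ 30 (sup|h| + ∫|h'|) t^{−1/2}`. -/
theorem stmt11 (a b A B t : ℝ) (hab : a < b) (hb : b ≤ 1) (hA : 0 ≤ A) (ht : 0 < t)
    (h h' : ℝ → ℂ)
    (hderiv : ∀ l ∈ Set.Icc a b, HasDerivWithinAt h (h' l) (Set.Icc a b) l)
    (hcont : ContinuousOn h' (Set.Icc a b)) :
    ‖∫ l in Set.Icc a b,
        Complex.exp (Complex.I * (t : ℂ) * (l : ℂ) ^ 2)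
          * Complex.exp (Complex.I * rhoPlus l * (A : ℂ))
          * Complex.exp (Complex.I * (l : ℂ) * (B : ℂ)) * h l‖
      ≤ 30 * ((⨆ l : Set.Icc a b, ‖h l‖) + ∫ l in Set.Icc a b, ‖h' l‖) * t ^ (-(1:ℝ)/2) := by
  have hbdd : BddAbove (Set.range fun l : Set.Icc a b => ‖h l‖) := by
    have hc : ContinuousOn (fun l => ‖h l‖) (Set.Icc a b) := fun x hx =>
      (hderiv x hx).continuousWithinAt.norm
    obtain ⟨C, hC⟩ := (isCompact_Icc.image_of_continuousOn hc).bddAbove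
    exact ⟨C, by rintro _ ⟨l, rfl⟩; exact hC ⟨l, l.2, rfl⟩⟩
  set M := ⨆ l : Set.Icc a b, ‖h l‖
  have hM : ∀ x ∈ Set.Icc a b, ‖h x‖ ≤ M := fun x hx => le_ciSup hbdd ⟨x, hx⟩
  have hM0 : 0 ≤ M := (norm_nonneg _).trans (hM a (Set.left_mem_Icc.2 hab.le))
  set F : ℝ → ℂ := fun l =>
    Complex.exp (I * ((t * l ^ 2 + B * l - A * Real.sqrt (l ^ 2 - 1) : ℝ) : ℂ))
      * (((Real.exp (-(A * Real.sqrt (1 - l ^ 2))) : ℝ) : ℂ) * h l) with hF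
  have hFc : ContinuousOn F (Set.Icc a b) := by
    have hc : ContinuousOn h (Set.Icc a b) := fun x hx => (hderiv x hx).continuousWithinAt
    refine ContinuousOn.mul ?_ (ContinuousOn.mul ?_ hc) <;> fun_prop
  have hFi : ∀ c ∈ Set.Icc a b, ∀ d ∈ Set.Icc a b, IntervalIntegrable F volume c d :=
    fun c hc d hd => (hFc.mono (Set.uIcc_subset_Icc hc hd)).intervalIntegrable
  rw [setIntegral_congr_fun (g := F) measurableSet_Icc fun l hl => by
      simp only [hF]
      rw [exp_mul_exp_rhoPlus_mul_exp (hl.2.trans hb), mul_assoc],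
    integral_Icc_eq_integral_Ioc, integral_Icc_eq_integral_Ioc,
    ← intervalIntegral.integral_of_le hab.le, ← intervalIntegral.integral_of_le hab.le]
  have hI0 : 0 ≤ ∫ x in a..b, ‖h' x‖ :=
    intervalIntegral.integral_nonneg hab.le fun _ _ => norm_nonneg _
  set S := M + ∫ x in a..b, ‖h' x‖
  have hS0 : 0 ≤ S := add_nonneg hM0 hI0
  set p := max a (min b (-1))
  set q := max a (min b 0)
  have hap : a ≤ p := le_max_left _ _
  have hpq : p ≤ q := max_le_max le_rfl (min_le_min le_rfl (by norm_num))
  have hqb : q ≤ b := max_le hab.le (min_le_left _ _)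
  have hp1 : ∀ x, x < p → a < x → x < -1 := fun x hx hax =>
    ((lt_max_iff.1 hx).resolve_left hax.not_gt).trans_le (min_le_right _ _)
  have hp2 : ∀ x, p < x → x < b → -1 < x := fun x hx hxb =>
    (min_lt_iff.1 ((le_max_right _ _).trans_lt hx)).resolve_left hxb.not_gt
  have hq1 : ∀ x, x < q → a < x → x < 0 := fun x hx hax =>
    ((lt_max_iff.1 hx).resolve_left hax.not_gt).trans_le (min_le_right _ _)
  have hq2 : ∀ x, q < x → x < b → 0 < x := fun x hx hxb =>
    (min_lt_iff.1 ((le_max_right _ _).trans_lt hx)).resolve_left hxb.not_gt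
  have i1 : ‖∫ l in a..p, F l‖ ≤ 8 * S / Real.sqrt (2 * t) :=
    norm_integral_piece_le (σ := -1) le_rfl hap (hpq.trans hqb) hA ht (by norm_num)
      (fun x hx => by nlinarith [hp1 x hx.2 hx.1])
      (fun x hx => by nlinarith [hp1 x hx.2 hx.1]) hderiv hcont hM
  have i2 : ‖∫ l in p..q, F l‖ ≤ 8 * S / Real.sqrt (2 * t) :=
    norm_integral_piece_le (σ := -1) hap hpq hqb hA ht (by norm_num)
      (fun x hx => by
        nlinarith [hp2 x hx.1 (hx.2.trans_le hqb), hq1 x hx.2 (hap.trans_lt hx.1)])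
      (fun x hx => by linarith [hq1 x hx.2 (hap.trans_lt hx.1)]) hderiv hcont hM
  have i3 : ‖∫ l in q..b, F l‖ ≤ 8 * S / Real.sqrt (2 * t) :=
    norm_integral_piece_le (σ := 1) (hap.trans hpq) hqb le_rfl hA ht (by norm_num)
      (fun x hx => by nlinarith [hq2 x hx.1 hx.2, hx.2])
      (fun x hx => by linarith [hq2 x hx.1 hx.2]) hderiv hcont hM
  have ha' : a ∈ Set.Icc a b := Set.left_mem_Icc.2 hab.le
  have hb' : b ∈ Set.Icc a b := Set.right_mem_Icc.2 hab.le
  have hp' : p ∈ Set.Icc a b := ⟨hap, hpq.trans hqb⟩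
  have hq' : q ∈ Set.Icc a b := ⟨hap.trans hpq, hqb⟩
  rw [← intervalIntegral.integral_add_adjacent_intervals (hFi a ha' q hq') (hFi q hq' b hb'),
    ← intervalIntegral.integral_add_adjacent_intervals (hFi a ha' p hp') (hFi p hp' q hq')]
  have ht' : t ^ (-(1:ℝ)/2) = 1 / Real.sqrt t := by
    rw [neg_div, Real.rpow_neg ht.le, Real.sqrt_eq_rpow, inv_eq_one_div]
  have hle : 8 * S / Real.sqrt (2 * t) ≤ 8 * S / Real.sqrt t := by
    have : Real.sqrt t ≤ Real.sqrt (2 * t) := Real.sqrt_le_sqrt (by linarith)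
    have := Real.sqrt_pos.2 ht
    gcongr
  have h24 : 24 * S / Real.sqrt t ≤ 30 * S * t ^ (-(1:ℝ)/2) := by
    rw [ht', mul_one_div]
    gcongr
    norm_num
  calc _ ≤ 8 * S / Real.sqrt t + 8 * S / Real.sqrt t + 8 * S / Real.sqrt t :=
        (norm_add_le _ _).trans (add_le_add ((norm_add_le _ _).trans
          (add_le_add (i1.trans hle) (i2.trans hle))) (i3.trans hle))
    _ = 24 * S / Real.sqrt t := by ring
    _ ≤ _ := h24
end

section
/- Let a < b ≤ −1, A ∈ ℝ, B ≤ 0, and let h ∈ C¹([a,b]) be complex valued. Then for all t > 0, |∫_a^b e^{itλ²} e^{iρ₊(λ)A} e^{iλB} h(λ) dλ| ≤ 30 (sup_{[a,b]}|h| + ∫_a^b |h'(λ)| dλ) t^{−1/2}. -/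
open MeasureTheory Complex

section VanDerCorput

variable {φ φ' φ'' : ℝ → ℝ}

theorem hasDerivAt_exp_I_mul (hφ : ∀ x, HasDerivAt φ (φ' x) x) (x : ℝ) :
    HasDerivAt (fun x => exp (I * (φ x : ℂ))) (exp (I * (φ x : ℂ)) * (I * (φ' x : ℂ))) x :=
  ((hφ x).ofReal_comp.const_mul I).cexp

theorem norm_integral_exp_le_of_le_deriv (hφ : ∀ x, HasDerivAt φ (φ' x) x)
    (hφ' : ∀ x, HasDerivAt φ' (φ'' x) x) (hc : Continuous φ'') (hnn : ∀ x, 0 ≤ φ'' x)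
    {c d m : ℝ} (hcd : c ≤ d) (hm : 0 < m) (hmc : m ≤ φ' c) :
    ‖∫ x in c..d, exp (I * (φ x : ℂ))‖ ≤ 2 / m := by
  have hmono : Monotone φ' := monotone_of_hasDerivAt_nonneg hφ' hnn
  have hpos : ∀ x ∈ Set.uIcc c d, 0 < φ' x := fun x hx => by
    rw [Set.uIcc_of_le hcd] at hx
    exact (hm.trans_le hmc).trans_le (hmono hx.1)
  have hcφ : Continuous φ := continuous_iff_continuousAt.2 fun x => (hφ x).continuousAt
  have hcφ' : Continuous φ' := continuous_iff_continuousAt.2 fun x => (hφ' x).continuousAt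
  have hinv : ∀ x ∈ Set.uIcc c d, HasDerivAt (fun x => (φ' x)⁻¹) (-φ'' x / φ' x ^ 2) x :=
    fun x hx => (hφ' x).inv (hpos x hx).ne'
  have hcinv : ContinuousOn (fun x => -φ'' x / φ' x ^ 2) (Set.uIcc c d) :=
    hc.neg.continuousOn.div (hcφ'.pow 2).continuousOn fun x hx => (pow_pos (hpos x hx) 2).ne'
  have hint : IntervalIntegrable (fun x => -φ'' x / φ' x ^ 2) volume c d :=
    hcinv.intervalIntegrable
  have hcu : ContinuousOn (fun x => -I * ((-φ'' x / φ' x ^ 2 : ℝ) : ℂ)) (Set.uIcc c d) :=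
    continuousOn_const.mul (continuous_ofReal.comp_continuousOn hcinv)
  have hu : ∀ x ∈ Set.uIcc c d, HasDerivAt (fun x => -I * (((φ' x)⁻¹ : ℝ) : ℂ))
      (-I * ((-φ'' x / φ' x ^ 2 : ℝ) : ℂ)) x :=
    fun x hx => (hinv x hx).ofReal_comp.const_mul _
  have hparts := intervalIntegral.integral_mul_deriv_eq_deriv_mul hu
    (fun x _ => hasDerivAt_exp_I_mul hφ x) (hcu.intervalIntegrable)
    (Continuous.intervalIntegrable (by fun_prop) _ _)
  have hlhs : ∫ x in c..d, exp (I * (φ x : ℂ)) = ∫ x in c..d,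
      -I * (((φ' x)⁻¹ : ℝ) : ℂ) * (exp (I * (φ x : ℂ)) * (I * (φ' x : ℂ))) := by
    refine intervalIntegral.integral_congr fun x hx => ?_
    have h0 : (φ' x : ℂ) ≠ 0 := ofReal_ne_zero.2 (hpos x hx).ne'
    have : -I * I = 1 := by simp
    push_cast
    field_simp
    linear_combination -this
  have hrest : ‖∫ x in c..d, -I * ((-φ'' x / φ' x ^ 2 : ℝ) : ℂ) * exp (I * (φ x : ℂ))‖
      ≤ (φ' c)⁻¹ - (φ' d)⁻¹ := by
    have := intervalIntegral.integral_eq_sub_of_hasDerivAt hinv hint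
    calc _ ≤ ∫ x in c..d, -(-φ'' x / φ' x ^ 2) := by
          refine intervalIntegral.norm_integral_le_of_norm_le hcd (.of_forall fun x _ => ?_)
            hint.neg
          rw [norm_mul, norm_exp_I_mul_ofReal, norm_mul, norm_neg, norm_I, norm_real, mul_one,
            one_mul, Real.norm_eq_abs, neg_div, abs_neg, neg_neg,
            abs_of_nonneg (div_nonneg (hnn x) (sq_nonneg _))]
      _ = _ := by rw [intervalIntegral.integral_neg, this]; ring
  have hnorm : ∀ x ∈ Set.uIcc c d,
      ‖-I * (((φ' x)⁻¹ : ℝ) : ℂ) * exp (I * (φ x : ℂ))‖ = (φ' x)⁻¹ := fun x hx => by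
    rw [norm_mul, norm_exp_I_mul_ofReal, norm_mul, norm_neg, norm_I, norm_real, mul_one,
      one_mul, Real.norm_eq_abs, abs_of_pos (inv_pos.2 (hpos x hx))]
  have hmc' : (φ' c)⁻¹ ≤ m⁻¹ := inv_anti₀ hm hmc
  rw [hlhs, hparts]
  calc _ ≤ (φ' d)⁻¹ + (φ' c)⁻¹ + ((φ' c)⁻¹ - (φ' d)⁻¹) := by
        refine (norm_sub_le _ _).trans (add_le_add ((norm_sub_le _ _).trans_eq ?_) hrest)
        rw [hnorm d Set.right_mem_uIcc, hnorm c Set.left_mem_uIcc]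
    _ = 2 * (φ' c)⁻¹ := by ring
    _ ≤ 2 / m := by rw [div_eq_mul_inv]; linarith

theorem norm_integral_exp_le_of_deriv_nonneg (hφ : ∀ x, HasDerivAt φ (φ' x) x)
    (hφ' : ∀ x, HasDerivAt φ' (φ'' x) x) (hc : Continuous φ'') {r : ℝ} (hr : 0 < r)
    (hle : ∀ x, r ^ 2 ≤ φ'' x) {c d : ℝ} (hcd : c ≤ d) (h0 : 0 ≤ φ' c) :
    ‖∫ x in c..d, exp (I * (φ x : ℂ))‖ ≤ 3 / r := by
  have hcφ : Continuous φ := continuous_iff_continuousAt.2 fun x => (hφ x).continuousAt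
  have htriv : ∀ e, c ≤ e → ‖∫ x in c..e, exp (I * (φ x : ℂ))‖ ≤ e - c := fun e he => by
    have := intervalIntegral.norm_integral_le_of_norm_le_const (a := c) (b := e)
      fun x _ => (norm_exp_I_mul_ofReal (φ x)).le
    rwa [one_mul, abs_of_nonneg (sub_nonneg.2 he)] at this
  have hrinv : 0 < r⁻¹ := inv_pos.2 hr
  rw [div_eq_mul_inv]
  rcases le_total d (c + r⁻¹) with hd | hd
  · linarith [htriv d hcd]
  · have hmono : Monotone fun x => φ' x - r ^ 2 * x := by
      refine monotone_of_hasDerivAt_nonneg (f' := fun x => φ'' x - r ^ 2) (fun x => ?_)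
        fun x => sub_nonneg.2 (hle x)
      exact ((hφ' x).sub ((hasDerivAt_id' x).const_mul (r ^ 2))).congr_deriv (by ring)
    have hstep : r ≤ φ' (c + r⁻¹) := by
      have h1 := hmono (show c ≤ c + r⁻¹ by linarith)
      have h2 : r ^ 2 * r⁻¹ = r := by field_simp
      simp only [mul_add, h2] at h1
      linarith
    have h2 := norm_integral_exp_le_of_le_deriv hφ hφ' hc (fun x => (sq_nonneg r).trans (hle x))
      hd hr hstep
    have hi : ∀ p q, IntervalIntegrable (fun x => exp (I * (φ x : ℂ))) volume p q :=
      fun p q => Continuous.intervalIntegrable (by fun_prop) _ _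
    rw [← intervalIntegral.integral_add_adjacent_intervals (hi c (c + r⁻¹)) (hi _ d)]
    have h1 := htriv (c + r⁻¹) (by linarith)
    rw [div_eq_mul_inv] at h2
    linarith [norm_add_le (∫ x in c..(c + r⁻¹), exp (I * (φ x : ℂ)))
      (∫ x in (c + r⁻¹)..d, exp (I * (φ x : ℂ)))]

theorem norm_integral_exp_le_of_deriv_nonpos (hφ : ∀ x, HasDerivAt φ (φ' x) x)
    (hφ' : ∀ x, HasDerivAt φ' (φ'' x) x) (hc : Continuous φ'') {r : ℝ} (hr : 0 < r)
    (hle : ∀ x, r ^ 2 ≤ φ'' x) {c d : ℝ} (hcd : c ≤ d) (h0 : φ' d ≤ 0) :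
    ‖∫ x in c..d, exp (I * (φ x : ℂ))‖ ≤ 3 / r := by
  have h := norm_integral_exp_le_of_deriv_nonneg (φ := fun x => φ (-x)) (φ' := fun x => -φ' (-x))
    (φ'' := fun x => φ'' (-x)) (fun x => ((hφ (-x)).comp x (hasDerivAt_neg x)).congr_deriv (by ring))
    (fun x => ((hφ' (-x)).comp x (hasDerivAt_neg x)).neg.congr_deriv (by ring)) (hc.comp continuous_neg)
    hr (fun x => hle _) (neg_le_neg hcd) (by simpa using h0)
  simpa [intervalIntegral.integral_comp_neg (fun x => exp (I * (φ x : ℂ)))] using h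

/-- The van der Corput estimate for a phase with second derivative at least `r ^ 2`. -/
theorem norm_integral_exp_le (hφ : ∀ x, HasDerivAt φ (φ' x) x)
    (hφ' : ∀ x, HasDerivAt φ' (φ'' x) x) (hc : Continuous φ'') {r : ℝ} (hr : 0 < r)
    (hle : ∀ x, r ^ 2 ≤ φ'' x) {c d : ℝ} (hcd : c ≤ d) :
    ‖∫ x in c..d, exp (I * (φ x : ℂ))‖ ≤ 6 / r := by
  have hcφ : Continuous φ := continuous_iff_continuousAt.2 fun x => (hφ x).continuousAt
  have hcφ' : Continuous φ' := continuous_iff_continuousAt.2 fun x => (hφ' x).continuousAt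
  have h36 : 3 / r ≤ 6 / r := by gcongr; norm_num
  by_cases h1 : 0 ≤ φ' c
  · exact (norm_integral_exp_le_of_deriv_nonneg hφ hφ' hc hr hle hcd h1).trans h36
  by_cases h2 : φ' d ≤ 0
  · exact (norm_integral_exp_le_of_deriv_nonpos hφ hφ' hc hr hle hcd h2).trans h36
  obtain ⟨e, he, he0⟩ := intermediate_value_Icc hcd hcφ'.continuousOn
    ⟨(not_le.1 h1).le, (not_le.1 h2).le⟩
  have hi : ∀ p q, IntervalIntegrable (fun x => exp (I * (φ x : ℂ))) volume p q :=
    fun p q => Continuous.intervalIntegrable (by fun_prop) _ _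
  rw [← intervalIntegral.integral_add_adjacent_intervals (hi c e) (hi e d)]
  calc _ ≤ 3 / r + 3 / r := (norm_add_le _ _).trans (add_le_add
        (norm_integral_exp_le_of_deriv_nonpos hφ hφ' hc hr hle he.1 he0.le)
        (norm_integral_exp_le_of_deriv_nonneg hφ hφ' hc hr hle he.2 he0.ge))
    _ = 6 / r := by ring

/-- The van der Corput estimate with an amplitude `ψ`. -/
theorem norm_integral_exp_mul_le_s12 (hφ : ∀ x, HasDerivAt φ (φ' x) x)
    (hφ' : ∀ x, HasDerivAt φ' (φ'' x) x) (hc : Continuous φ'') {r : ℝ} (hr : 0 < r)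
    (hle : ∀ x, r ^ 2 ≤ φ'' x) {c d : ℝ} (hcd : c ≤ d) {ψ ψ' : ℝ → ℂ}
    (hψ : ∀ x ∈ Set.Icc c d, HasDerivWithinAt ψ (ψ' x) (Set.Icc c d) x)
    (hψ' : ContinuousOn ψ' (Set.Icc c d)) :
    ‖∫ x in c..d, exp (I * (φ x : ℂ)) * ψ x‖ ≤ 6 / r * (‖ψ d‖ + ∫ x in c..d, ‖ψ' x‖) := by
  have hcφ : Continuous φ := continuous_iff_continuousAt.2 fun x => (hφ x).continuousAt
  have hce : Continuous fun x => exp (I * (φ x : ℂ)) := by fun_prop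
  have hF : ∀ x, HasDerivAt (fun y => ∫ s in c..y, exp (I * (φ s : ℂ)))
      (exp (I * (φ x : ℂ))) x := fun x => (hce.integral_hasStrictDerivAt c x).hasDerivAt
  rw [← Set.uIcc_of_le hcd] at hψ hψ'
  have hparts := intervalIntegral.integral_mul_deriv_eq_deriv_mul_of_hasDerivWithinAt hψ
    (fun x _ => (hF x).hasDerivWithinAt) hψ'.intervalIntegrable (hce.intervalIntegrable _ _)
  simp_rw [mul_comm (ψ _)] at hparts
  rw [hparts, intervalIntegral.integral_same, zero_mul, sub_zero, mul_add,
    ← intervalIntegral.integral_const_mul]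
  refine (norm_sub_le _ _).trans (add_le_add ?_ ?_)
  · rw [norm_mul]
    gcongr
    exact norm_integral_exp_le hφ hφ' hc hr hle hcd
  · refine intervalIntegral.norm_integral_le_of_norm_le hcd (.of_forall fun x hx => ?_)
      (hψ'.norm.intervalIntegrable.const_mul _)
    rw [norm_mul, mul_comm]
    gcongr
    exact norm_integral_exp_le hφ hφ' hc hr hle hx.1.le

end VanDerCorput

section JapaneseBracket

/-- The Japanese bracket `⟨x⟩ = (1 + x²)^{1/2}`. -/
noncomputable def japaneseBracket (x : ℝ) : ℝ := Real.sqrt (1 + x ^ 2)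

theorem japaneseBracket_pos (x : ℝ) : 0 < japaneseBracket x := Real.sqrt_pos.2 (by positivity)

theorem japaneseBracket_sq (x : ℝ) : japaneseBracket x ^ 2 = 1 + x ^ 2 :=
  Real.sq_sqrt (by positivity)

theorem continuous_japaneseBracket : Continuous japaneseBracket :=
  Real.continuous_sqrt.comp (by fun_prop)

theorem hasDerivAt_japaneseBracket (x : ℝ) :
    HasDerivAt japaneseBracket (x / japaneseBracket x) x := by
  have h : HasDerivAt (fun x : ℝ => 1 + x ^ 2) (2 * x) x :=
    (((hasDerivAt_pow 2 x).const_add 1)).congr_deriv (by simp)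
  refine (h.sqrt (by positivity)).congr_deriv ?_
  have := (japaneseBracket_pos x).ne'
  unfold japaneseBracket at *
  field_simp

theorem hasDerivAt_div_japaneseBracket (x : ℝ) :
    HasDerivAt (fun x => x / japaneseBracket x) (1 / japaneseBracket x ^ 3) x := by
  refine ((hasDerivAt_id' x).div (hasDerivAt_japaneseBracket x)
    (japaneseBracket_pos x).ne').congr_deriv ?_
  have := (japaneseBracket_pos x).ne'
  field_simp
  linear_combination japaneseBracket_sq x

theorem abs_div_japaneseBracket_le_one (x : ℝ) : |x / japaneseBracket x| ≤ 1 := by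
  rw [abs_div, abs_of_pos (japaneseBracket_pos x), div_le_one (japaneseBracket_pos x)]
  exact Real.abs_le_sqrt (by linarith)

theorem japaneseBracket_neg_sqrt {l : ℝ} (hl : l ≤ -1) :
    japaneseBracket (-Real.sqrt (l ^ 2 - 1)) = -l := by
  rw [japaneseBracket, neg_sq, Real.sq_sqrt (by nlinarith), add_sub_cancel, ← neg_sq,
    Real.sqrt_sq (by linarith)]

theorem japaneseBracket_le_of_nonpos {x y : ℝ} (hxy : x ≤ y) (hy : y ≤ 0) :
    japaneseBracket y ≤ japaneseBracket x :=
  Real.sqrt_le_sqrt (by nlinarith)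

theorem rhoPlus_of_le {l : ℝ} (hl : l ≤ -1) : rhoPlus l = ((-Real.sqrt (l ^ 2 - 1) : ℝ) : ℂ) := by
  rw [rhoPlus, if_neg (by linarith)]
  rcases hl.lt_or_eq with h | rfl
  · simp [h]
  · simp

theorem rhoPlus_neg_japaneseBracket {x : ℝ} (hx : x ≤ 0) :
    rhoPlus (-japaneseBracket x) = (x : ℂ) := by
  have h1 : 1 ≤ japaneseBracket x := Real.one_le_sqrt.2 (by nlinarith)
  rw [rhoPlus_of_le (by linarith), neg_sq, japaneseBracket_sq, add_sub_cancel_left,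
    Real.sqrt_sq_eq_abs, abs_of_nonpos hx, neg_neg]

theorem integral_deriv_smul_comp_neg_japaneseBracket {E : Type*} [NormedAddCommGroup E]
    [NormedSpace ℝ E] {a b : ℝ} (hab : a ≤ b) (hb : b ≤ -1) {g : ℝ → E}
    (hg : ContinuousOn g (Set.Icc a b)) :
    ∫ x in -Real.sqrt (a ^ 2 - 1)..-Real.sqrt (b ^ 2 - 1),
      (-(x / japaneseBracket x)) • g (-japaneseBracket x) = ∫ l in Set.Icc a b, g l := by
  have hα : -Real.sqrt (a ^ 2 - 1) ≤ -Real.sqrt (b ^ 2 - 1) :=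
    neg_le_neg (Real.sqrt_le_sqrt (by nlinarith))
  have hβ : -Real.sqrt (b ^ 2 - 1) ≤ 0 := neg_nonpos.2 (Real.sqrt_nonneg _)
  have h := intervalIntegral.integral_deriv_smul_comp' (a := -Real.sqrt (a ^ 2 - 1))
    (b := -Real.sqrt (b ^ 2 - 1)) (f := fun x => -japaneseBracket x) (g := g)
    (fun x _ => (hasDerivAt_japaneseBracket x).neg)
    (fun x _ => (hasDerivAt_div_japaneseBracket x).neg.continuousAt.continuousWithinAt)
    (hg.mono ?_)
  · simp only [japaneseBracket_neg_sqrt hb, japaneseBracket_neg_sqrt (hab.trans hb), neg_neg] at h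
    rw [integral_Icc_eq_integral_Ioc, ← intervalIntegral.integral_of_le hab, ← h]
    rfl
  · rw [Set.uIcc_of_le hα]
    rintro _ ⟨x, hx, rfl⟩
    have h1 := japaneseBracket_le_of_nonpos hx.1 (hx.2.trans hβ)
    have h2 := japaneseBracket_le_of_nonpos hx.2 hβ
    rw [japaneseBracket_neg_sqrt (hab.trans hb)] at h1
    rw [japaneseBracket_neg_sqrt hb] at h2
    constructor <;> simp only <;> linarith

end JapaneseBracket

/-- Van der Corput type estimate:
`|∫_a^b e^{itλ²} e^{iρ₊(λ)A} e^{iλB} h(λ) dλ| ≤ 30 (sup|h| + ∫|h'|) t^{−1/2}`. -/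
theorem stmt12 (a b A B t : ℝ) (hab : a < b) (hb : b ≤ -1) (hB : B ≤ 0) (ht : 0 < t)
    (h h' : ℝ → ℂ)
    (hderiv : ∀ l ∈ Set.Icc a b, HasDerivWithinAt h (h' l) (Set.Icc a b) l)
    (hcont : ContinuousOn h' (Set.Icc a b)) :
    ‖∫ l in Set.Icc a b,
        Complex.exp (Complex.I * (t : ℂ) * (l : ℂ) ^ 2)
          * Complex.exp (Complex.I * rhoPlus l * (A : ℂ))
          * Complex.exp (Complex.I * (l : ℂ) * (B : ℂ)) * h l‖
      ≤ 30 * ((⨆ l : Set.Icc a b, ‖h l‖) + ∫ l in Set.Icc a b, ‖h' l‖) * t ^ (-(1:ℝ)/2) := by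
  set α := -Real.sqrt (a ^ 2 - 1) with hα
  set β := -Real.sqrt (b ^ 2 - 1) with hβ
  have ha : a ≤ -1 := hab.le.trans hb
  have hαβ : α ≤ β := neg_le_neg (Real.sqrt_le_sqrt (by nlinarith))
  have hβ0 : β ≤ 0 := neg_nonpos.2 (Real.sqrt_nonneg _)
  have hmaps : Set.MapsTo (fun x => -japaneseBracket x) (Set.Icc α β) (Set.Icc a b) := by
    intro x hx
    have h1 := japaneseBracket_le_of_nonpos hx.1 (hx.2.trans hβ0)
    have h2 := japaneseBracket_le_of_nonpos hx.2 hβ0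
    rw [hα, japaneseBracket_neg_sqrt ha] at h1
    rw [hβ, japaneseBracket_neg_sqrt hb] at h2
    exact ⟨by linarith, by linarith⟩
  have hcw := continuous_japaneseBracket
  have hcp : Continuous fun x => x / japaneseBracket x :=
    continuous_id.div hcw fun x => (japaneseBracket_pos x).ne'
  have hcq : Continuous fun x => 1 / japaneseBracket x ^ 3 :=
    continuous_const.div (hcw.pow 3) fun x => (pow_pos (japaneseBracket_pos x) 3).ne'
  have hch : ContinuousOn h (Set.Icc a b) := fun l hl => (hderiv l hl).continuousWithinAt
  set S := ⨆ l : Set.Icc a b, ‖h l‖ with hS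
  have hbdd : BddAbove (Set.range fun l : Set.Icc a b => ‖h l‖) := by
    have := (isCompact_Icc.image_of_continuousOn hch.norm).bddAbove
    rwa [Set.image_eq_range] at this
  have hleS : ∀ l ∈ Set.Icc a b, ‖h l‖ ≤ S := fun l hl => le_ciSup hbdd ⟨l, hl⟩
  have hS0 : 0 ≤ S := (norm_nonneg _).trans (hleS a ⟨le_rfl, hab.le⟩)
  -- the phase after the change of variables `l = -⟨x⟩`
  have hφ : ∀ x, HasDerivAt (fun x => t * (1 + x ^ 2) + x * A - japaneseBracket x * B)
      (2 * t * x + A - x / japaneseBracket x * B) x := fun x =>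
    (((((hasDerivAt_pow 2 x).const_add 1).const_mul t).add
      ((hasDerivAt_id' x).mul_const A)).sub
      ((hasDerivAt_japaneseBracket x).mul_const B)).congr_deriv (by simp; ring)
  have hφ' : ∀ x, HasDerivAt (fun x => 2 * t * x + A - x / japaneseBracket x * B)
      (2 * t - 1 / japaneseBracket x ^ 3 * B) x := fun x =>
    ((((hasDerivAt_id' x).const_mul (2 * t)).add_const A).sub
      ((hasDerivAt_div_japaneseBracket x).mul_const B)).congr_deriv (by ring)
  have hr : 0 < Real.sqrt (2 * t) := Real.sqrt_pos.2 (by linarith)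
  have hle : ∀ x, Real.sqrt (2 * t) ^ 2 ≤ 2 * t - 1 / japaneseBracket x ^ 3 * B := fun x => by
    rw [Real.sq_sqrt (by linarith)]
    have : 0 < 1 / japaneseBracket x ^ 3 := one_div_pos.2 (pow_pos (japaneseBracket_pos x) 3)
    nlinarith
  -- the amplitude after the change of variables
  have hψ : ∀ x ∈ Set.Icc α β, HasDerivWithinAt
      (fun x => ((-(x / japaneseBracket x) : ℝ) : ℂ) * h (-japaneseBracket x))
      (((-(1 / japaneseBracket x ^ 3) : ℝ) : ℂ) * h (-japaneseBracket x)
        + ((-(x / japaneseBracket x) : ℝ) : ℂ)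
          * ((-(x / japaneseBracket x)) • h' (-japaneseBracket x))) (Set.Icc α β) x :=
    fun x hx => (hasDerivAt_div_japaneseBracket x).neg.ofReal_comp.hasDerivWithinAt.mul
      ((hderiv _ (hmaps hx)).scomp x (hasDerivAt_japaneseBracket x).neg.hasDerivWithinAt hmaps)
  have hchw := hch.comp hcw.neg.continuousOn hmaps
  have hchw' := hcont.comp hcw.neg.continuousOn hmaps
  have hψ' : ContinuousOn (fun x =>
      ((-(1 / japaneseBracket x ^ 3) : ℝ) : ℂ) * h (-japaneseBracket x)
        + ((-(x / japaneseBracket x) : ℝ) : ℂ)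
          * ((-(x / japaneseBracket x)) • h' (-japaneseBracket x))) (Set.Icc α β) :=
    ((continuous_ofReal.comp hcq.neg).continuousOn.mul hchw).add
      ((continuous_ofReal.comp hcp.neg).continuousOn.mul (hcp.neg.continuousOn.smul hchw'))
  have hvdc := norm_integral_exp_mul_le_s12 hφ hφ' (continuous_const.sub (hcq.mul continuous_const)) hr
    hle hαβ hψ hψ'
  have hp0 : ∀ x ≤ 0, 0 ≤ -(x / japaneseBracket x) := fun x hx =>
    neg_nonneg.2 (div_nonpos_of_nonpos_of_nonneg hx (japaneseBracket_pos x).le)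
  have hp1 : ∀ x, -(x / japaneseBracket x) ≤ 1 := fun x =>
    (neg_le_abs _).trans (abs_div_japaneseBracket_le_one x)
  have hsubst : ∫ l in Set.Icc a b, exp (I * (t : ℂ) * (l : ℂ) ^ 2) * exp (I * rhoPlus l * (A : ℂ))
        * exp (I * (l : ℂ) * (B : ℂ)) * h l
      = ∫ x in α..β, exp (I * ((t * (1 + x ^ 2) + x * A - japaneseBracket x * B : ℝ) : ℂ))
        * (((-(x / japaneseBracket x) : ℝ) : ℂ) * h (-japaneseBracket x)) := by
    rw [← integral_deriv_smul_comp_neg_japaneseBracket hab.le hb]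
    · refine intervalIntegral.integral_congr fun x hx => ?_
      rw [Set.uIcc_of_le hαβ] at hx
      have hsq : ((japaneseBracket x : ℝ) : ℂ) ^ 2 = 1 + (x : ℂ) ^ 2 := by
        exact_mod_cast congrArg ofReal (japaneseBracket_sq x)
      simp only [rhoPlus_neg_japaneseBracket (hx.2.trans hβ0), real_smul, ← exp_add]
      push_cast
      rw [neg_sq, hsq, mul_left_comm]
      congr 3
      ring
    · have hcρ : ContinuousOn rhoPlus (Set.Icc a b) :=
        ContinuousOn.congr (f := fun l => ((-Real.sqrt (l ^ 2 - 1) : ℝ) : ℂ)) (by fun_prop)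
          fun l hl => rhoPlus_of_le (hl.2.trans hb)
      fun_prop
  have hvar : ∫ x in α..β, ‖((-(1 / japaneseBracket x ^ 3) : ℝ) : ℂ) * h (-japaneseBracket x)
        + ((-(x / japaneseBracket x) : ℝ) : ℂ)
          * ((-(x / japaneseBracket x)) • h' (-japaneseBracket x))‖
      ≤ (β / japaneseBracket β - α / japaneseBracket α) * S + ∫ l in Set.Icc a b, ‖h' l‖ := by
    rw [← integral_deriv_smul_comp_neg_japaneseBracket hab.le hb hcont.norm,
      ← intervalIntegral.integral_eq_sub_of_hasDerivAt
        (fun x _ => hasDerivAt_div_japaneseBracket x) (hcq.intervalIntegrable _ _),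
      ← intervalIntegral.integral_mul_const]
    have hi1 : IntervalIntegrable (fun x => 1 / japaneseBracket x ^ 3 * S) volume α β :=
      (hcq.mul continuous_const).intervalIntegrable _ _
    have hi2 : IntervalIntegrable
        (fun x => (-(x / japaneseBracket x)) • ‖h' (-japaneseBracket x)‖) volume α β := by
      refine ContinuousOn.intervalIntegrable ?_
      rw [Set.uIcc_of_le hαβ]
      exact hcp.neg.continuousOn.smul hchw'.norm
    rw [← intervalIntegral.integral_add hi1 hi2]
    refine intervalIntegral.integral_mono_on hαβ ?_ (hi1.add hi2) fun x hx => ?_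
    · refine ContinuousOn.intervalIntegrable ?_
      rw [Set.uIcc_of_le hαβ]
      exact hψ'.norm
    · have hq : 0 ≤ 1 / japaneseBracket x ^ 3 :=
        one_div_nonneg.2 (pow_nonneg (japaneseBracket_pos x).le 3)
      have hp := hp0 x (hx.2.trans hβ0)
      refine (norm_add_le _ _).trans (add_le_add ?_ ?_)
      · rw [norm_mul, norm_real, norm_neg, Real.norm_of_nonneg hq]
        exact mul_le_mul_of_nonneg_left (hleS _ (hmaps hx)) hq
      · rw [norm_mul, norm_smul, norm_real, Real.norm_of_nonneg hp, smul_eq_mul]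
        exact mul_le_of_le_one_left (mul_nonneg hp (norm_nonneg _)) (hp1 x)
  have hend : ‖((-(β / japaneseBracket β) : ℝ) : ℂ) * h (-japaneseBracket β)‖
      ≤ -(β / japaneseBracket β) * S := by
    rw [norm_mul, norm_real, Real.norm_of_nonneg (hp0 β hβ0)]
    exact mul_le_mul_of_nonneg_left (hleS _ (hmaps ⟨hαβ, le_rfl⟩)) (hp0 β hβ0)
  have hV : 0 ≤ ∫ l in Set.Icc a b, ‖h' l‖ := integral_nonneg fun _ => norm_nonneg _
  have hconst : 6 / Real.sqrt (2 * t) ≤ 30 * t ^ (-(1 : ℝ) / 2) := by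
    have hst : 0 < Real.sqrt t := Real.sqrt_pos.2 ht
    rw [neg_div, Real.rpow_neg ht.le, ← Real.sqrt_eq_rpow, ← div_eq_mul_inv]
    exact div_le_div₀ (by norm_num) (by norm_num) hst (Real.sqrt_le_sqrt (by linarith))
  rw [hsubst]
  calc _ ≤ 6 / Real.sqrt (2 * t) * (S + ∫ l in Set.Icc a b, ‖h' l‖) := by
        refine hvdc.trans (mul_le_mul_of_nonneg_left ?_ (by positivity))
        have := mul_le_mul_of_nonneg_right (hp1 α) hS0
        linarith
    _ ≤ 30 * t ^ (-(1 : ℝ) / 2) * (S + ∫ l in Set.Icc a b, ‖h' l‖) := by gcongr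
    _ = _ := by ring
end

section
/- For every χ ∈ C¹(ℝ) with compact support and every real A ≠ 0, |∫_0^∞ e^{iλA} χ(λ) λ^{−1/2} dλ| ≤ 5 ‖χ'‖_{L¹(ℝ)} |A|^{−1/2}. -/
open MeasureTheory Complex

theorem inv_sqrt_eq_rpow {t : ℝ} (ht : 0 ≤ t) : (Real.sqrt t)⁻¹ = t ^ (-(1:ℝ)/2) := by
  rw [Real.sqrt_eq_rpow, ← Real.rpow_neg ht]
  norm_num

theorem intervalIntegrable_inv_sqrt {a b : ℝ} (ha : 0 ≤ a) (hb : 0 ≤ b) :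
    IntervalIntegrable (fun t : ℝ => (Real.sqrt t)⁻¹) volume a b := by
  refine (intervalIntegral.intervalIntegrable_rpow' (a := a) (b := b)
    (r := -(1:ℝ)/2) (by norm_num)).congr ?_
  intro t ht
  exact (inv_sqrt_eq_rpow ((le_min ha hb).trans ht.1.le)).symm

theorem integral_inv_sqrt {x : ℝ} (hx : 0 ≤ x) :
    ∫ t in (0:ℝ)..x, (Real.sqrt t)⁻¹ = 2 * Real.sqrt x := by
  have h : ∫ t in (0:ℝ)..x, (Real.sqrt t)⁻¹ = ∫ t in (0:ℝ)..x, t ^ (-(1:ℝ)/2) := by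
    refine intervalIntegral.integral_congr fun t ht => ?_
    rw [Set.uIcc_of_le hx] at ht
    exact inv_sqrt_eq_rpow ht.1
  rw [h, integral_rpow (Or.inl (by norm_num)), Real.sqrt_eq_rpow]
  norm_num
  ring

theorem norm_exp_I_mul_mul (t A : ℝ) : ‖exp (I * (t : ℂ) * (A : ℂ))‖ = 1 := by
  have h : I * (t : ℂ) * (A : ℂ) = ((t * A : ℝ) : ℂ) * I := by push_cast; ring
  rw [h, norm_exp_ofReal_mul_I]

theorem intervalIntegrable_ofReal {f : ℝ → ℝ} {a b : ℝ} (hf : IntervalIntegrable f volume a b) :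
    IntervalIntegrable (fun t => (f t : ℂ)) volume a b :=
  ⟨Integrable.ofReal hf.1, Integrable.ofReal hf.2⟩

theorem intervalIntegrable_exp_mul_inv_sqrt (A : ℝ) {a b : ℝ} (ha : 0 ≤ a) (hb : 0 ≤ b) :
    IntervalIntegrable (fun t : ℝ => exp (I * (t : ℂ) * (A : ℂ)) * (((Real.sqrt t)⁻¹ : ℝ) : ℂ))
      volume a b :=
  IntervalIntegrable.continuousOn_mul (intervalIntegrable_ofReal (intervalIntegrable_inv_sqrt ha hb))
    (by fun_prop)

theorem norm_integral_exp_mul_inv_sqrt_le_near (A : ℝ) {x : ℝ} (hx : 0 ≤ x) :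
    ‖∫ t in (0:ℝ)..x, exp (I * (t : ℂ) * (A : ℂ)) * (((Real.sqrt t)⁻¹ : ℝ) : ℂ)‖
      ≤ 2 * Real.sqrt x := by
  refine (intervalIntegral.norm_integral_le_integral_norm hx).trans_eq ?_
  rw [← integral_inv_sqrt hx]
  refine intervalIntegral.integral_congr fun t _ => ?_
  simp only [norm_mul, norm_exp_I_mul_mul, one_mul, norm_real, Real.norm_eq_abs]
  exact abs_of_nonneg (by positivity)

theorem hasDerivAt_inv_sqrt {t : ℝ} (ht : 0 < t) :
    HasDerivAt (fun t : ℝ => (Real.sqrt t)⁻¹) (-(1 / (2 * Real.sqrt t)) / Real.sqrt t ^ 2) t :=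
  (Real.hasDerivAt_sqrt ht.ne').fun_inv (Real.sqrt_pos.2 ht).ne'

theorem norm_integral_exp_mul_inv_sqrt_le_far {A : ℝ} (hA : A ≠ 0) {a x : ℝ} (ha : 0 < a)
    (hx : a ≤ x) :
    ‖∫ t in a..x, exp (I * (t : ℂ) * (A : ℂ)) * (((Real.sqrt t)⁻¹ : ℝ) : ℂ)‖
      ≤ 2 * (Real.sqrt a)⁻¹ / |A| := by
  set d : ℝ → ℝ := fun t => -(1 / (2 * Real.sqrt t)) / Real.sqrt t ^ 2
  set v : ℝ → ℂ := fun t => exp (I * (t : ℂ) * (A : ℂ)) / (I * A) with hv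
  have hAc : (A : ℂ) ≠ 0 := ofReal_ne_zero.2 hA
  have hpos : ∀ t ∈ Set.uIcc a x, 0 < t := fun t ht => by
    rw [Set.uIcc_of_le hx] at ht; exact ha.trans_le ht.1
  have hd : ∀ t ∈ Set.uIcc a x, HasDerivAt (fun t : ℝ => (Real.sqrt t)⁻¹) (d t) t :=
    fun t ht => hasDerivAt_inv_sqrt (hpos t ht)
  have hdv : ∀ t : ℝ, HasDerivAt v (exp (I * (t : ℂ) * (A : ℂ))) t := fun t => by
    have h1 : HasDerivAt (fun t : ℝ => I * (t : ℂ) * (A : ℂ)) (I * 1 * A) t :=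
      ((ofRealCLM.hasDerivAt (x := t)).const_mul I).mul_const (A : ℂ)
    have h2 := h1.cexp.div_const (I * A)
    rwa [mul_one, mul_div_assoc, div_self (mul_ne_zero I_ne_zero hAc), mul_one] at h2
  have hnv : ∀ t, ‖v t‖ = 1 / |A| := fun t => by
    simp [hv, norm_exp_I_mul_mul]
  have hdc : ContinuousOn d (Set.uIcc a x) := by
    have : ∀ t ∈ Set.uIcc a x, Real.sqrt t ≠ 0 := fun t ht => (Real.sqrt_pos.2 (hpos t ht)).ne'
    refine ContinuousOn.div (ContinuousOn.neg (ContinuousOn.div (by fun_prop) (by fun_prop) ?_))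
      (by fun_prop) ?_
    · intro t ht; simpa using this t ht
    · intro t ht; exact pow_ne_zero _ (this t ht)
  have hdneg : ∀ t, d t ≤ 0 := fun t => by
    simp only [d, neg_div]
    exact neg_nonpos.2 (by positivity)
  have hparts := intervalIntegral.integral_mul_deriv_eq_deriv_mul
    (u := fun t : ℝ => (((Real.sqrt t)⁻¹ : ℝ) : ℂ)) (u' := fun t => (d t : ℂ))
    (v := v) (v' := fun t : ℝ => exp (I * (t : ℂ) * (A : ℂ)))
    (fun t ht => (hd t ht).ofReal_comp) (fun t _ => hdv t)
    (intervalIntegrable_ofReal hdc.intervalIntegrable) (Continuous.intervalIntegrable (by fun_prop) _ _)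
  have hrest : ‖∫ t in a..x, (d t : ℂ) * v t‖ ≤ ((Real.sqrt a)⁻¹ - (Real.sqrt x)⁻¹) / |A| := by
    refine (intervalIntegral.norm_integral_le_integral_norm hx).trans_eq ?_
    have h1 : ∀ t, ‖(d t : ℂ) * v t‖ = d t * (-(1 / |A|)) := fun t => by
      rw [norm_mul, hnv, norm_real, Real.norm_eq_abs, abs_of_nonpos (hdneg t)]
      ring
    simp only [h1]
    rw [intervalIntegral.integral_mul_const,
      intervalIntegral.integral_eq_sub_of_hasDerivAt hd hdc.intervalIntegrable]
    ring
  have hu : ∀ t : ℝ, ‖(((Real.sqrt t)⁻¹ : ℝ) : ℂ) * v t‖ = (Real.sqrt t)⁻¹ / |A| := fun t => by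
    rw [norm_mul, hnv, norm_real, Real.norm_eq_abs, abs_of_nonneg (by positivity)]
    ring
  simp only [mul_comm (exp _)]
  rw [hparts]
  refine ((norm_sub_le _ _).trans (add_le_add (norm_sub_le _ _) hrest)).trans_eq ?_
  rw [hu, hu]
  ring

theorem norm_integral_exp_mul_inv_sqrt_le {A : ℝ} (hA : A ≠ 0) {x : ℝ} (hx : 0 ≤ x) :
    ‖∫ t in (0:ℝ)..x, exp (I * (t : ℂ) * (A : ℂ)) * (((Real.sqrt t)⁻¹ : ℝ) : ℂ)‖
      ≤ 4 * (Real.sqrt |A|)⁻¹ := by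
  have hA' : 0 < |A| := abs_pos.2 hA
  have hs : 0 < Real.sqrt |A| := Real.sqrt_pos.2 hA'
  rcases le_total x |A|⁻¹ with h | h
  · refine (norm_integral_exp_mul_inv_sqrt_le_near A hx).trans ?_
    have := Real.sqrt_le_sqrt h
    rw [Real.sqrt_inv] at this
    linarith [inv_pos.2 hs]
  · have ha : 0 < |A|⁻¹ := inv_pos.2 hA'
    rw [← intervalIntegral.integral_add_adjacent_intervals
      (intervalIntegrable_exp_mul_inv_sqrt A le_rfl ha.le)
      (intervalIntegrable_exp_mul_inv_sqrt A ha.le hx)]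
    refine ((norm_add_le _ _).trans (add_le_add
      (norm_integral_exp_mul_inv_sqrt_le_near A ha.le)
      (norm_integral_exp_mul_inv_sqrt_le_far hA ha h))).trans_eq ?_
    have h2 : Real.sqrt |A| / |A| = (Real.sqrt |A|)⁻¹ := Real.sqrt_div_self
    rw [Real.sqrt_inv, inv_inv, mul_div_assoc, h2]
    ring

/-- For every `χ ∈ C¹(ℝ)` with compact support and every `A ≠ 0`,
`|∫_0^∞ e^{iλA} χ(λ) λ^{−1/2} dλ| ≤ 5 ‖χ'‖_{L¹} |A|^{−1/2}`. -/
theorem stmt13 (χ : ℝ → ℂ) (hχ : ContDiff ℝ 1 χ) (hsupp : HasCompactSupport χ)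
    (A : ℝ) (hA : A ≠ 0) :
    ‖∫ l in Set.Ioi (0:ℝ),
        Complex.exp (Complex.I * (l : ℂ) * (A : ℂ)) * χ l * (((Real.sqrt l)⁻¹ : ℝ) : ℂ)‖
      ≤ 5 * (∫ l : ℝ, ‖deriv χ l‖) * |A| ^ (-(1:ℝ)/2) := by
  rw [← inv_sqrt_eq_rpow (abs_nonneg A)]
  have hdc : Continuous (deriv χ) := hχ.continuous_deriv le_rfl
  have hint : Integrable (fun l => ‖deriv χ l‖) :=
    (hdc.integrable_of_hasCompactSupport hsupp.deriv).norm
  obtain ⟨R, hR0, hR⟩ : ∃ R : ℝ, 0 < R ∧ ∀ l, R ≤ l → χ l = 0 := by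
    obtain ⟨R, hR⟩ := hsupp.isCompact.bddAbove
    refine ⟨max R 0 + 1, by positivity, fun l hl => image_eq_zero_of_notMem_tsupport fun h => ?_⟩
    linarith [hR h, le_max_left R 0]
  set g : ℝ → ℂ := fun t => exp (I * (t : ℂ) * (A : ℂ)) * (((Real.sqrt t)⁻¹ : ℝ) : ℂ) with hg
  set F : ℝ → ℂ := fun x => ∫ t in (0:ℝ)..x, g t with hF
  have hgi : IntervalIntegrable g volume 0 R :=
    intervalIntegrable_exp_mul_inv_sqrt A le_rfl hR0.le
  have hFc : ContinuousOn F (Set.uIcc 0 R) :=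
    intervalIntegral.continuousOn_primitive_interval
      (by rw [Set.uIcc_of_le hR0.le]
          exact (intervalIntegrable_iff_integrableOn_Icc_of_le hR0.le).1 hgi)
  have hFd : ∀ t, 0 < t → HasDerivAt F (g t) t := fun t ht => by
    have hgc : ContinuousOn g (Set.Ioi 0) := by
      refine ContinuousOn.mul (by fun_prop) (continuous_ofReal.comp_continuousOn ?_)
      exact Real.continuous_sqrt.continuousOn.inv₀ fun s hs => (Real.sqrt_pos.2 hs).ne'
    exact intervalIntegral.integral_hasDerivAt_right
      (intervalIntegrable_exp_mul_inv_sqrt A le_rfl ht.le)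
      (hgc.stronglyMeasurableAtFilter isOpen_Ioi t ht)
      (hgc.continuousAt (Ioi_mem_nhds ht))
  have htrunc : ∫ l in Set.Ioi (0:ℝ), exp (I * (l : ℂ) * (A : ℂ)) * χ l *
      (((Real.sqrt l)⁻¹ : ℝ) : ℂ) = ∫ l in (0:ℝ)..R, χ l * g l := by
    rw [intervalIntegral.integral_of_le hR0.le]
    refine (setIntegral_eq_of_subset_of_forall_sdiff_eq_zero measurableSet_Ioi
      Set.Ioc_subset_Ioi_self fun l hl => ?_).trans (integral_congr_ae (.of_forall fun l => ?_))
    · have : R ≤ l := by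
        by_contra! h
        exact hl.2 ⟨hl.1, h.le⟩
      simp [hR l this]
    · simp only [hg]
      ring
  have hparts : ∫ l in (0:ℝ)..R, χ l * g l = -∫ l in (0:ℝ)..R, deriv χ l * F l := by
    rw [intervalIntegral.integral_mul_deriv_eq_deriv_mul_of_hasDerivAt
      (u := χ) (v := F) (u' := deriv χ) (v' := g) hχ.continuous.continuousOn hFc
      (fun t _ => (hχ.differentiable one_ne_zero t).hasDerivAt)
      (fun t ht => hFd t (by simpa [hR0.le] using ht.1))
      (hdc.intervalIntegrable _ _) hgi]
    simp [hF, hR R le_rfl]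
  rw [htrunc, hparts, norm_neg]
  have hs : 0 ≤ (Real.sqrt |A|)⁻¹ := by positivity
  calc ‖∫ l in (0:ℝ)..R, deriv χ l * F l‖
      ≤ ∫ l in (0:ℝ)..R, ‖deriv χ l‖ * (4 * (Real.sqrt |A|)⁻¹) := by
        refine intervalIntegral.norm_integral_le_of_norm_le hR0.le (.of_forall fun l hl => ?_)
          ((hdc.norm.mul continuous_const).intervalIntegrable _ _)
        rw [norm_mul]
        gcongr
        exact norm_integral_exp_mul_inv_sqrt_le hA hl.1.le
    _ = (∫ l in Set.Ioc 0 R, ‖deriv χ l‖) * (4 * (Real.sqrt |A|)⁻¹) := by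
        rw [intervalIntegral.integral_mul_const, intervalIntegral.integral_of_le hR0.le]
    _ ≤ (∫ l : ℝ, ‖deriv χ l‖) * (5 * (Real.sqrt |A|)⁻¹) := by
        exact mul_le_mul (setIntegral_le_integral hint (.of_forall fun _ => norm_nonneg _))
          (by linarith) (by positivity) (integral_nonneg fun _ => norm_nonneg _)
    _ = 5 * (∫ l : ℝ, ‖deriv χ l‖) * (Real.sqrt |A|)⁻¹ := by ring
end

section
/- For every χ ∈ C²(ℝ) with compact support and every real A ≠ 0, |∫_0^∞ e^{iλA} χ(λ) λ^{1/2} dλ| ≤ 5 ‖χ''/2 + λχ'‖_{L¹(ℝ)} |A|^{−3/2}, where ‖χ''/2 + λχ'‖_{L¹} = ∫_ℝ |χ''(λ)/2 + λχ'(λ)| dλ. -/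
open MeasureTheory Complex

/-- Mean value inequality on a closed interval, with derivatives only required in the interior. -/
theorem norm_sub_le_sub_of_hasDerivAt {f f' : ℝ → ℂ} {B B' : ℝ → ℝ} {a b : ℝ} (hab : a ≤ b)
    (hf : ContinuousOn f (Set.Icc a b)) (hB : ContinuousOn B (Set.Icc a b))
    (hf' : ∀ x ∈ Set.Ioo a b, HasDerivAt f (f' x) x)
    (hB' : ∀ x ∈ Set.Ioo a b, HasDerivAt B (B' x) x)
    (bound : ∀ x ∈ Set.Ioo a b, ‖f' x‖ ≤ B' x) :
    ‖f b - f a‖ ≤ B b - B a := by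
  rcases hab.eq_or_lt with rfl | hlt
  · simp
  have key : ∀ c ∈ Set.Ioo a b, ‖f b - f c‖ ≤ B b - B c := by
    intro c hc
    have hsub : Set.Icc c b ⊆ Set.Icc a b := Set.Icc_subset_Icc_left hc.1.le
    have hsub' : Set.Ico c b ⊆ Set.Ioo a b := fun x hx => ⟨hc.1.trans_le hx.1, hx.2⟩
    exact image_norm_le_of_norm_deriv_right_le_deriv_boundary' (f := fun x => f x - f c)
      (B := fun x => B x - B c) (f' := f') (B' := B')
      ((hf.mono hsub).sub continuousOn_const)
      (fun x hx => ((hf' x (hsub' hx)).sub_const _).hasDerivWithinAt) (by simp)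
      ((hB.mono hsub).sub continuousOn_const)
      (fun x hx => ((hB' x (hsub' hx)).sub_const _).hasDerivWithinAt)
      (fun x hx => bound x (hsub' hx)) ⟨hc.2.le, le_rfl⟩
  have hmem : Set.Ioo a b ∈ nhdsWithin a (Set.Ioo a b) := self_mem_nhdsWithin
  have : (nhdsWithin a (Set.Ioo a b)).NeBot := by
    rw [← mem_closure_iff_nhdsWithin_neBot, closure_Ioo hlt.ne]; exact ⟨le_rfl, hab⟩
  have h1 := (hf a ⟨le_rfl, hab⟩).mono_left (nhdsWithin_mono a Set.Ioo_subset_Icc_self)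
  have h2 := (hB a ⟨le_rfl, hab⟩).mono_left (nhdsWithin_mono a Set.Ioo_subset_Icc_self)
  exact le_of_tendsto_of_tendsto (tendsto_const_nhds.sub h1).norm (tendsto_const_nhds.sub h2)
    (Filter.eventually_of_mem hmem key)

/-- The phase `e^{iAx}`. -/
noncomputable def phase (A x : ℝ) : ℂ := Complex.exp (Complex.I * (x : ℂ) * (A : ℂ))

theorem norm_phase (A x : ℝ) : ‖phase A x‖ = 1 := by
  have : Complex.I * (x : ℂ) * (A : ℂ) = ((x * A : ℝ) : ℂ) * Complex.I := by push_cast; ring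
  rw [phase, this, Complex.norm_exp_ofReal_mul_I]

theorem hasDerivAt_phase (A x : ℝ) : HasDerivAt (phase A) (phase A x * (Complex.I * A)) x := by
  have h : HasDerivAt (fun y : ℝ => Complex.I * (y : ℂ) * (A : ℂ)) (Complex.I * 1 * A) x :=
    ((Complex.ofRealCLM.hasDerivAt (x := x)).const_mul Complex.I).mul_const (A : ℂ)
  refine h.cexp.congr_deriv ?_
  simp [phase]

theorem continuous_phase (A : ℝ) : Continuous (phase A) :=
  continuous_iff_continuousAt.2 fun x => (hasDerivAt_phase A x).continuousAt

/-- The primitive `∫₀ˣ e^{iAu} u^{1/2} du`, which vanishes for `x ≤ 0`. -/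
noncomputable def oscPrim (A x : ℝ) : ℂ := ∫ u in (0:ℝ)..x, phase A u * ((Real.sqrt u : ℝ) : ℂ)

theorem continuous_phase_mul_sqrt (A : ℝ) :
    Continuous fun u : ℝ => phase A u * ((Real.sqrt u : ℝ) : ℂ) :=
  (continuous_phase A).mul (Complex.continuous_ofReal.comp Real.continuous_sqrt)

theorem hasDerivAt_oscPrim (A x : ℝ) :
    HasDerivAt (oscPrim A) (phase A x * ((Real.sqrt x : ℝ) : ℂ)) x :=
  (continuous_phase_mul_sqrt A).integral_hasStrictDerivAt 0 x |>.hasDerivAt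

theorem continuous_oscPrim (A : ℝ) : Continuous (oscPrim A) :=
  continuous_iff_continuousAt.2 fun x => (hasDerivAt_oscPrim A x).continuousAt

theorem oscPrim_zero (A : ℝ) : oscPrim A 0 = 0 := by simp [oscPrim]

theorem oscPrim_of_nonpos (A : ℝ) {x : ℝ} (hx : x ≤ 0) : oscPrim A x = 0 := by
  rw [oscPrim, intervalIntegral.integral_congr (g := fun _ => 0)]
  · simp
  · intro u hu
    rw [Set.uIcc_of_ge hx] at hu
    simp [Real.sqrt_eq_zero_of_nonpos hu.2]

theorem norm_oscPrim_le_cube (A : ℝ) {x : ℝ} (hx : 0 ≤ x) :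
    ‖oscPrim A x‖ ≤ 2 / 3 * (x * Real.sqrt x) := by
  have h := norm_sub_le_sub_of_hasDerivAt (f := oscPrim A) (B := fun x => 2 / 3 * (x * Real.sqrt x))
    (B' := fun x => Real.sqrt x) hx (continuous_oscPrim A).continuousOn (by fun_prop)
    (fun y _ => hasDerivAt_oscPrim A y) ?_ ?_
  · simpa [oscPrim_zero] using h
  · intro y hy
    have hy0 : 0 < Real.sqrt y := Real.sqrt_pos.2 hy.1
    refine HasDerivAt.congr_deriv (((hasDerivAt_id y).mul (Real.hasDerivAt_sqrt hy.1.ne')).const_mul (2 / 3 : ℝ)) ?_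
    field_simp
    simp only [id]
    nlinarith [Real.sq_sqrt hy.1.le]
  · intro y hy
    simp [norm_phase, abs_of_nonneg (Real.sqrt_nonneg y)]

/-- The remainder of `oscPrim` after one integration by parts. -/
noncomputable def oscRem (A x : ℝ) : ℂ :=
  oscPrim A x - phase A x * ((Real.sqrt x : ℝ) : ℂ) / (Complex.I * A)

theorem continuous_oscRem (A : ℝ) : Continuous (oscRem A) :=
  (continuous_oscPrim A).sub ((continuous_phase_mul_sqrt A).div_const _)

theorem oscRem_zero (A : ℝ) : oscRem A 0 = 0 := by simp [oscRem, oscPrim_zero]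

theorem hasDerivAt_ofReal_sqrt {x : ℝ} (hx : 0 < x) :
    HasDerivAt (fun y : ℝ => ((Real.sqrt y : ℝ) : ℂ)) (1 / (2 * (Real.sqrt x : ℂ))) x := by
  simpa using (Real.hasDerivAt_sqrt hx.ne').ofReal_comp

theorem hasDerivAt_oscRem {A x : ℝ} (hA : A ≠ 0) (hx : 0 < x) :
    HasDerivAt (oscRem A) (-(phase A x / (2 * (Real.sqrt x : ℂ) * (Complex.I * A)))) x := by
  have hA' : (A : ℂ) ≠ 0 := by exact_mod_cast hA
  have hs : (Real.sqrt x : ℂ) ≠ 0 := by exact_mod_cast (Real.sqrt_pos.2 hx).ne'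
  refine HasDerivAt.congr_deriv ((hasDerivAt_oscPrim A x).sub
    (((hasDerivAt_phase A x).mul (hasDerivAt_ofReal_sqrt hx)).div_const (Complex.I * A))) ?_
  field_simp
  ring

theorem norm_oscRem_le {A x : ℝ} (hA : A ≠ 0) (hx : 0 ≤ x) :
    ‖oscRem A x‖ ≤ Real.sqrt x / |A| := by
  have h := norm_sub_le_sub_of_hasDerivAt (f := oscRem A) (B := fun x => Real.sqrt x / |A|)
    (B' := fun x => 1 / (2 * Real.sqrt x) / |A|) hx (continuous_oscRem A).continuousOn
    (by fun_prop) (fun y hy => hasDerivAt_oscRem hA hy.1)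
    (fun y hy => (Real.hasDerivAt_sqrt hy.1.ne').div_const _) ?_
  · simpa [oscRem_zero] using h
  · intro y hy
    simp only [norm_neg, norm_div, norm_mul, norm_phase, Complex.norm_real, Real.norm_eq_abs,
      abs_of_nonneg (Real.sqrt_nonneg y), Complex.norm_I, Complex.norm_ofNat, one_mul, div_div]
    exact le_rfl

theorem norm_oscPrim_le_sqrt {A x : ℝ} (hA : A ≠ 0) (hx : 0 ≤ x) :
    ‖oscPrim A x‖ ≤ 2 * Real.sqrt x / |A| := by
  have h : oscPrim A x = oscRem A x + phase A x * ((Real.sqrt x : ℝ) : ℂ) / (Complex.I * A) := by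
    simp [oscRem]
  have h2 : ‖phase A x * ((Real.sqrt x : ℝ) : ℂ) / (Complex.I * A)‖ = Real.sqrt x / |A| := by
    simp [norm_phase, abs_of_nonneg (Real.sqrt_nonneg x)]
  rw [h]
  refine (norm_add_le _ _).trans ?_
  rw [h2, two_mul, add_div]
  exact add_le_add_left (norm_oscRem_le hA hx) _

theorem norm_oscPrim_le_linear {A x : ℝ} (hA : A ≠ 0) (hx : 0 ≤ x) :
    ‖oscPrim A x‖ ≤ 2 / Real.sqrt 3 / Real.sqrt |A| * x := by
  have hA' : 0 < |A| := abs_pos.2 hA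
  refine abs_le_of_sq_le_sq' ?_ (by positivity) |>.2
  calc ‖oscPrim A x‖ ^ 2 ≤ (2 / 3 * (x * Real.sqrt x)) * (2 * Real.sqrt x / |A|) := by
        rw [sq]
        exact mul_le_mul (norm_oscPrim_le_cube A hx) (norm_oscPrim_le_sqrt hA hx)
          (norm_nonneg _) (by positivity)
    _ = _ := by
        rw [mul_pow, div_pow, div_pow, Real.sq_sqrt hA'.le, Real.sq_sqrt (by norm_num)]
        field_simp
        rw [Real.sq_sqrt hx, sq]

/-- Positive part of `1 - √(|A| x)`, squared. -/
noncomputable def bump (A x : ℝ) : ℝ := (max 0 (1 - Real.sqrt |A| * Real.sqrt x)) ^ 2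

theorem exists_norm_oscRem_sub_le {A : ℝ} (hA : A ≠ 0) :
    ∃ c : ℂ, ‖c‖ ≤ 1 / Real.sqrt |A| ^ 3 ∧
      ∀ x, 0 ≤ x → ‖oscRem A x - c‖ ≤ 1 / 2 / Real.sqrt |A| ^ 3 * (1 + bump A x) := by
  obtain ⟨s, hs, hsA⟩ : ∃ s : ℝ, 0 < s ∧ Real.sqrt |A| = s := ⟨_, Real.sqrt_pos.2 (abs_pos.2 hA), rfl⟩
  have hA2 : |A| = s ^ 2 := by rw [← hsA, Real.sq_sqrt (abs_nonneg A)]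
  have hA4 : A ^ 2 = s ^ 4 := by rw [← sq_abs, hA2]; ring
  have hsC : (s : ℂ) ≠ 0 := by exact_mod_cast hs.ne'
  have hAC : (A : ℂ) ≠ 0 := by exact_mod_cast hA
  have hA4C : (A : ℂ) ^ 2 = s ^ 4 := by exact_mod_cast hA4
  simp only [bump, hsA]
  set a : ℝ := 1 / s ^ 2 with ha
  have ha0 : 0 < a := by positivity
  have hsqa : Real.sqrt a = 1 / s := by
    rw [ha, show 1 / s ^ 2 = (1 / s) ^ 2 by ring, Real.sqrt_sq (by positivity)]
  -- near zero, the correction is frozen at its value at `a`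
  have near : ∀ x, 0 ≤ x → x ≤ a →
      ‖(oscRem A a - phase A a / (2 * s ^ 3)) - (oscRem A x - phase A x / (2 * s ^ 3))‖
        ≤ 1 / 2 / s ^ 3 * (1 - s * Real.sqrt x) ^ 2 := by
    intro x hx hxa
    have h := norm_sub_le_sub_of_hasDerivAt
      (f := fun y => oscRem A y - phase A y / (2 * s ^ 3))
      (f' := fun y => -(phase A y / (2 * (Real.sqrt y : ℂ) * (Complex.I * A)))
        - phase A y * (Complex.I * A) / (2 * s ^ 3))
      (B := fun y => -(1 / 2 / s ^ 3 * (1 - s * Real.sqrt y) ^ 2))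
      (B' := fun y => 1 / (2 * s ^ 2) * (1 / Real.sqrt y - s)) hxa
      (((continuous_oscRem A).sub ((continuous_phase A).div_const _)).continuousOn)
      (by fun_prop)
      (fun y hy => (hasDerivAt_oscRem hA (hx.trans_lt hy.1)).sub
        ((hasDerivAt_phase A y).div_const _)) ?_ ?_
    · have e : s * Real.sqrt a = 1 := by rw [hsqa]; field_simp
      simp only [e] at h
      linarith
    · intro y hy
      have hy0 : 0 < y := hx.trans_lt hy.1
      have hy1 : 0 < Real.sqrt y := Real.sqrt_pos.2 hy0
      refine HasDerivAt.congr_deriv ((((((Real.hasDerivAt_sqrt hy0.ne').const_mul s).const_sub 1).pow 2).const_mul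
        (1 / 2 / s ^ 3)).neg) ?_
      field_simp
      simp
    · intro y hy
      have hy0 : 0 < y := hx.trans_lt hy.1
      have hy1 : 0 < Real.sqrt y := Real.sqrt_pos.2 hy0
      have hyC : (Real.sqrt y : ℂ) ≠ 0 := by exact_mod_cast hy1.ne'
      have hya : Real.sqrt y ≤ 1 / s := hsqa ▸ Real.sqrt_le_sqrt hy.2.le
      have e : -(phase A y / (2 * (Real.sqrt y : ℂ) * (Complex.I * A)))
          - phase A y * (Complex.I * A) / (2 * s ^ 3)
          = phase A y * Complex.I / A * ((1 / 2 * (1 / Real.sqrt y - s) : ℝ) : ℂ) := by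
        push_cast
        field_simp
        rw [hA4C, Complex.I_sq]
        ring
      have hnn : 0 ≤ 1 / Real.sqrt y - s := by
        rw [sub_nonneg, le_div_iff₀ hy1]
        rw [le_div_iff₀ hs] at hya
        linarith
      rw [e, norm_mul, norm_div, norm_mul, norm_phase, Complex.norm_I, Complex.norm_real,
        Complex.norm_real, Real.norm_eq_abs, Real.norm_eq_abs, hA2,
        abs_of_nonneg (by positivity : (0:ℝ) ≤ 1 / 2 * (1 / Real.sqrt y - s))]
      apply le_of_eq
      field_simp
  have far : ∀ x, a ≤ x →
      ‖(oscRem A x - phase A x / (2 * s ^ 4 * Real.sqrt x))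
        - (oscRem A a - phase A a / (2 * s ^ 3))‖ ≤ 1 / 2 / s ^ 3 - 1 / 2 / s ^ 4 / Real.sqrt x := by
    intro x hx
    have hpos : ∀ y ∈ Set.Icc a x, 0 < Real.sqrt y := fun y hy =>
      Real.sqrt_pos.2 (ha0.trans_le hy.1)
    have h := norm_sub_le_sub_of_hasDerivAt
      (f := fun y => oscRem A y - phase A y / (2 * s ^ 4 * Real.sqrt y))
      (f' := fun y => phase A y / (4 * s ^ 4 * Real.sqrt y ^ 3))
      (B := fun y => -(1 / 2 / s ^ 4 / Real.sqrt y))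
      (B' := fun y => 1 / (4 * s ^ 4 * Real.sqrt y ^ 3)) hx ?_ ?_ ?_ ?_ ?_
    · have e : (2 * s ^ 4 * (Real.sqrt a : ℂ)) = 2 * s ^ 3 := by
        rw [hsqa]; push_cast; field_simp
      have e' : -(1 / 2 / s ^ 4 / Real.sqrt a) = -(1 / 2 / s ^ 3) := by
        rw [hsqa]; field_simp
      simp only [e, e'] at h
      linarith
    · refine (continuous_oscRem A).continuousOn.sub ((continuous_phase A).continuousOn.div
        (by fun_prop) ?_)
      intro y hy
      have : (Real.sqrt y : ℂ) ≠ 0 := by exact_mod_cast (hpos y hy).ne'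
      simp [hsC, this]
    · exact (continuousOn_const.div (by fun_prop) fun y hy => (hpos y hy).ne').neg
    · intro y hy
      have hy0 : 0 < y := ha0.trans hy.1
      have hyC : (Real.sqrt y : ℂ) ≠ 0 := by exact_mod_cast (Real.sqrt_pos.2 hy0).ne'
      refine HasDerivAt.congr_deriv ((hasDerivAt_oscRem hA hy0).sub ((hasDerivAt_phase A y).div
        ((hasDerivAt_ofReal_sqrt hy0).const_mul (2 * (s : ℂ) ^ 4)) (by simp [hsC, hyC]))) ?_
      field_simp
      rw [← hA4C]
      ring_nf
      simp [Complex.I_sq]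
    · intro y hy
      have hy0 : 0 < y := ha0.trans hy.1
      have hy1 : 0 < Real.sqrt y := Real.sqrt_pos.2 hy0
      refine HasDerivAt.congr_deriv (((hasDerivAt_const y (1 / 2 / s ^ 4)).div
        (Real.hasDerivAt_sqrt hy0.ne') hy1.ne').neg) ?_
      field_simp
      ring
    · intro y hy
      simp [norm_phase, abs_of_pos hs, abs_of_nonneg (Real.sqrt_nonneg y)]
  have hn3 : ∀ x, ‖phase A x / (2 * (s : ℂ) ^ 3)‖ = 1 / 2 / s ^ 3 := fun x => by
    simp [norm_phase, abs_of_pos hs]; ring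
  refine ⟨oscRem A a - phase A a / (2 * s ^ 3), ?_, ?_⟩
  · have h0 := near 0 le_rfl ha0.le
    simp only [oscRem_zero, Real.sqrt_zero] at h0
    have := norm_sub_norm_le (oscRem A a - phase A a / (2 * s ^ 3)) (0 - phase A 0 / (2 * s ^ 3))
    rw [zero_sub, norm_neg, hn3] at this
    rw [zero_sub] at h0
    have e : 1 / s ^ 3 = 1 / 2 / s ^ 3 * (1 - s * 0) ^ 2 + 1 / 2 / s ^ 3 := by ring
    linarith
  · intro x hx
    rcases le_total x a with hxa | hxa
    · have h0 := near x hx hxa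
      rw [norm_sub_rev] at h0
      have h1 : s * Real.sqrt x ≤ 1 := by
        have := Real.sqrt_le_sqrt hxa
        rw [hsqa, le_div_iff₀ hs] at this
        linarith
      rw [max_eq_right (by linarith)]
      have h2 := norm_add_le (oscRem A x - phase A x / (2 * s ^ 3)
        - (oscRem A a - phase A a / (2 * s ^ 3))) (phase A x / (2 * s ^ 3))
      rw [hn3] at h2
      have e : oscRem A x - (oscRem A a - phase A a / (2 * s ^ 3))
        = oscRem A x - phase A x / (2 * s ^ 3)
        - (oscRem A a - phase A a / (2 * s ^ 3)) + phase A x / (2 * s ^ 3) := by ring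
      rw [e, mul_add]
      linarith
    · have h0 := far x hxa
      have h2 := norm_add_le (oscRem A x - phase A x / (2 * s ^ 4 * Real.sqrt x)
        - (oscRem A a - phase A a / (2 * s ^ 3))) (phase A x / (2 * s ^ 4 * Real.sqrt x))
      have e : oscRem A x - (oscRem A a - phase A a / (2 * s ^ 3))
        = oscRem A x - phase A x / (2 * s ^ 4 * Real.sqrt x)
        - (oscRem A a - phase A a / (2 * s ^ 3)) + phase A x / (2 * s ^ 4 * Real.sqrt x) := by ring
      have hn : ‖phase A x / (2 * (s : ℂ) ^ 4 * Real.sqrt x)‖ = 1 / 2 / s ^ 4 / Real.sqrt x := by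
        simp [norm_phase, abs_of_pos hs, abs_of_nonneg (Real.sqrt_nonneg x)]; ring
      rw [hn] at h2
      have h3 : 0 ≤ 1 / 2 / s ^ 3 * (max 0 (1 - s * Real.sqrt x)) ^ 2 := by positivity
      rw [e, mul_add]
      linarith

theorem setIntegral_Ioi_eq_shift (F : ℝ → ℝ) (x : ℝ) :
    ∫ t in Set.Ioi x, F t = ∫ t in Set.Ioi 0, F (t + x) := by
  have h := (measurePreserving_add_right volume x).setIntegral_preimage_emb
    (measurableEmbedding_addRight x) F (Set.Ioi x)
  rw [← h]
  congr 2
  ext t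
  simp

theorem setIntegral_exp_neg_sq_mul_le {φ : ℝ → ℝ} (hanti : AntitoneOn φ (Set.Ioi 0))
    (hpos : ∀ t, 0 < t → 0 ≤ φ t)
    (hint : IntegrableOn (fun t => Real.exp (-t ^ 2) * φ t) (Set.Ioi 0)) {x : ℝ} (hx : 0 ≤ x) :
    ∫ t in Set.Ioi x, Real.exp (-t ^ 2) * φ t
      ≤ Real.exp (-x ^ 2) * ∫ t in Set.Ioi 0, Real.exp (-t ^ 2) * φ t := by
  rw [setIntegral_Ioi_eq_shift, ← integral_const_mul]
  refine integral_mono_of_nonneg ?_ (hint.const_mul _) ?_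
  · filter_upwards [self_mem_ae_restrict measurableSet_Ioi] with t ht
    exact mul_nonneg (Real.exp_pos _).le (hpos _ (add_pos_of_pos_of_nonneg ht hx))
  · filter_upwards [self_mem_ae_restrict measurableSet_Ioi] with t ht
    have ht0 : 0 < t := ht
    rw [← mul_assoc, ← Real.exp_add]
    refine mul_le_mul (Real.exp_le_exp.2 (by nlinarith))
      (hanti ht (add_pos_of_pos_of_nonneg ht0 hx) (by linarith))
      (hpos _ (add_pos_of_pos_of_nonneg ht0 hx)) (Real.exp_pos _).le

theorem integrable_exp_neg_sq : Integrable fun t : ℝ => Real.exp (-t ^ 2) := by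
  simpa using integrable_exp_neg_mul_sq (b := 1) one_pos

theorem integral_exp_neg_sq_Ioi : ∫ t in Set.Ioi (0:ℝ), Real.exp (-t ^ 2) = Real.sqrt Real.pi / 2 := by
  simpa using integral_gaussian_Ioi 1

theorem setIntegral_exp_neg_sq_le {x : ℝ} (hx : 0 ≤ x) :
    ∫ t in Set.Ioi x, Real.exp (-t ^ 2) ≤ Real.exp (-x ^ 2) * (Real.sqrt Real.pi / 2) := by
  simpa [integral_exp_neg_sq_Ioi] using setIntegral_exp_neg_sq_mul_le (φ := fun _ => 1)
    antitoneOn_const (fun _ _ => zero_le_one) (by simpa using integrable_exp_neg_sq.integrableOn) hx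

theorem integrableOn_exp_neg_sq_div_sqrt :
    IntegrableOn (fun t => Real.exp (-t ^ 2) * (1 / Real.sqrt t)) (Set.Ioi 0) := by
  refine (integrableOn_rpow_mul_exp_neg_mul_sq (b := 1) one_pos (s := -(1/2)) (by norm_num)).congr_fun
    (fun t ht => ?_) measurableSet_Ioi
  have ht0 : (0:ℝ) ≤ t := le_of_lt ht
  simp only [Real.sqrt_eq_rpow, Real.rpow_neg ht0, one_div, neg_mul, one_mul]
  ring

theorem integral_exp_neg_sq_div_sqrt_le :
    ∫ t in Set.Ioi (0:ℝ), Real.exp (-t ^ 2) * (1 / Real.sqrt t) ≤ 1 + Real.sqrt Real.pi / 2 := by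
  have h := integral_rpow_mul_exp_neg_rpow (p := 2) (q := -(1/2)) two_pos (by norm_num)
  have e : ∫ t in Set.Ioi (0:ℝ), Real.exp (-t ^ 2) * (1 / Real.sqrt t)
      = ∫ t in Set.Ioi (0:ℝ), t ^ (-(1/2) : ℝ) * Real.exp (-t ^ (2:ℝ)) := by
    refine setIntegral_congr_fun measurableSet_Ioi fun t ht => ?_
    have ht0 : (0:ℝ) ≤ t := le_of_lt ht
    simp only [Real.sqrt_eq_rpow, Real.rpow_neg ht0, one_div, Real.rpow_two]
    ring
  rw [e, h]
  have h1 : Real.Gamma (1 / 4 + 1) = 1 / 4 * Real.Gamma (1 / 4) := Real.Gamma_add_one (by norm_num)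
  have h2 : Real.Gamma (1 / 2 + 1) = 1 / 2 * Real.Gamma (1 / 2) := Real.Gamma_add_one (by norm_num)
  have h3 := Real.convexOn_Gamma.2 (Set.mem_Ioi.2 (one_pos : (0:ℝ) < 1))
    (Set.mem_Ioi.2 (by norm_num : (0:ℝ) < 1 / 2 + 1))
    (by norm_num : (0:ℝ) ≤ 1 / 2) (by norm_num : (0:ℝ) ≤ 1 / 2) (by norm_num)
  simp only [smul_eq_mul] at h3
  rw [h2, Real.Gamma_one, Real.Gamma_one_half_eq,
    show (1 / 2 * 1 + 1 / 2 * (1 / 2 + 1) : ℝ) = 1 / 4 + 1 by norm_num, h1] at h3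
  rw [show ((-(1 / 2) + 1) / 2 : ℝ) = 1 / 4 by norm_num]
  linarith

theorem continuous_bump (A : ℝ) : Continuous (bump A) := by unfold bump; fun_prop

theorem bump_nonneg (A x : ℝ) : 0 ≤ bump A x := sq_nonneg _

theorem antitone_bump (A : ℝ) : Antitone (bump A) := by
  intro x y hxy
  refine pow_le_pow_left₀ (le_max_left _ _) (max_le_max le_rfl ?_) 2
  have := mul_le_mul_of_nonneg_left (Real.sqrt_le_sqrt hxy) (Real.sqrt_nonneg |A|)
  linarith

theorem bump_le_one (A x : ℝ) : bump A x ≤ 1 := by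
  refine pow_le_one₀ (le_max_left _ _) (max_le zero_le_one ?_)
  have : 0 ≤ Real.sqrt |A| * Real.sqrt x := by positivity
  linarith

theorem integrable_exp_neg_sq_mul_bump (A : ℝ) :
    Integrable fun t => Real.exp (-t ^ 2) * bump A t := by
  refine integrable_exp_neg_sq.mono'
    ((by fun_prop : Continuous fun t : ℝ => Real.exp (-t ^ 2)).mul
      (continuous_bump A)).aestronglyMeasurable (Filter.Eventually.of_forall fun t => ?_)
  rw [Real.norm_of_nonneg (mul_nonneg (Real.exp_pos _).le (bump_nonneg A t))]
  exact mul_le_of_le_one_right (Real.exp_pos _).le (bump_le_one A t)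

theorem integral_exp_neg_sq_mul_bump_le {A : ℝ} (hA : A ≠ 0) :
    ∫ t in Set.Ioi (0:ℝ), Real.exp (-t ^ 2) * bump A t ≤ 1 / (6 * Real.sqrt |A| ^ 2) := by
  obtain ⟨s, hs, hsA⟩ : ∃ s : ℝ, 0 < s ∧ Real.sqrt |A| = s := ⟨_, Real.sqrt_pos.2 (abs_pos.2 hA), rfl⟩
  set a : ℝ := 1 / s ^ 2 with ha
  have ha0 : 0 < a := by positivity
  have hsqa : Real.sqrt a = 1 / s := by
    rw [ha, show 1 / s ^ 2 = (1 / s) ^ 2 by ring, Real.sqrt_sq (by positivity)]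
  have hzero : ∀ t ∈ Set.Ioi (0:ℝ) \ Set.Ioc 0 a, Real.exp (-t ^ 2) * bump A t = 0 := by
    intro t ht
    have hta : a < t := by
      by_contra hcon
      exact ht.2 ⟨ht.1, not_lt.1 hcon⟩
    have := Real.sqrt_le_sqrt hta.le
    rw [hsqa, div_le_iff₀ hs] at this
    rw [bump, hsA, max_eq_left (by linarith)]
    simp
  rw [setIntegral_eq_of_subset_of_forall_sdiff_eq_zero measurableSet_Ioi
    (fun t ht => ht.1) hzero]
  calc ∫ t in Set.Ioc 0 a, Real.exp (-t ^ 2) * bump A t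
      ≤ ∫ t in Set.Ioc 0 a, (1 - 2 * s * Real.sqrt t + s ^ 2 * t) := by
        refine setIntegral_mono_on (integrable_exp_neg_sq_mul_bump A).integrableOn
          ((by fun_prop : Continuous fun t : ℝ =>
            1 - 2 * s * Real.sqrt t + s ^ 2 * t).integrableOn_Ioc) measurableSet_Ioc ?_
        intro t ht
        have h1 := Real.sqrt_le_sqrt ht.2
        rw [hsqa, le_div_iff₀ hs] at h1
        refine (mul_le_of_le_one_left (bump_nonneg A t) (Real.exp_le_one_iff.2
          (by nlinarith [sq_nonneg t]))).trans_eq ?_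
        rw [bump, hsA, max_eq_right (by linarith)]
        nlinarith [Real.sq_sqrt ht.1.le]
    _ = 1 / (6 * Real.sqrt |A| ^ 2) := by
        rw [← intervalIntegral.integral_of_le ha0.le,
          intervalIntegral.integral_eq_sub_of_hasDerivAt_of_le
            (f := fun t => t - 4 / 3 * s * (t * Real.sqrt t) + s ^ 2 / 2 * t ^ 2) ha0.le
            (by fun_prop) ?_ ((by fun_prop : Continuous fun t : ℝ =>
              1 - 2 * s * Real.sqrt t + s ^ 2 * t).intervalIntegrable _ _)]
        · simp only [hsqa, hsA, Real.sqrt_zero]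
          rw [ha]
          field_simp
          norm_num
        · intro t ht
          have ht1 : 0 < Real.sqrt t := Real.sqrt_pos.2 ht.1
          refine (((hasDerivAt_id t).sub (((hasDerivAt_id t).mul
            (Real.hasDerivAt_sqrt ht.1.ne')).const_mul (4 / 3 * s))).add
            ((hasDerivAt_pow 2 t).const_mul (s ^ 2 / 2))).congr_deriv ?_
          simp only [id]
          push_cast
          field_simp
          linear_combination 4 * s * Real.sq_sqrt ht.1.le

/-- The majorant of the non-oscillating error in `oscPrim`. -/
noncomputable def oscMajorant (A t : ℝ) : ℝ :=
  1 / 2 / Real.sqrt |A| ^ 3 * (1 + bump A t) + 1 / (2 * Real.sqrt |A| ^ 4) * (1 / Real.sqrt t)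

theorem oscMajorant_nonneg (A t : ℝ) : 0 ≤ oscMajorant A t := by
  have := bump_nonneg A t
  unfold oscMajorant
  positivity

theorem antitoneOn_oscMajorant (A : ℝ) : AntitoneOn (oscMajorant A) (Set.Ioi 0) := by
  intro x hx y hy hxy
  have hx0 : 0 < Real.sqrt x := Real.sqrt_pos.2 hx
  refine add_le_add (mul_le_mul_of_nonneg_left ?_ (by positivity))
    (mul_le_mul_of_nonneg_left ?_ (by positivity))
  · linarith [antitone_bump A hxy]
  · exact one_div_le_one_div_of_le hx0 (Real.sqrt_le_sqrt hxy)

theorem exp_neg_sq_mul_oscMajorant (A t : ℝ) :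
    Real.exp (-t ^ 2) * oscMajorant A t =
      1 / 2 / Real.sqrt |A| ^ 3 * (Real.exp (-t ^ 2) + Real.exp (-t ^ 2) * bump A t)
      + 1 / (2 * Real.sqrt |A| ^ 4) * (Real.exp (-t ^ 2) * (1 / Real.sqrt t)) := by
  unfold oscMajorant
  ring

theorem integrableOn_oscMajorant (A : ℝ) :
    IntegrableOn (fun t => Real.exp (-t ^ 2) * oscMajorant A t) (Set.Ioi 0) := by
  simp only [exp_neg_sq_mul_oscMajorant]
  exact ((integrable_exp_neg_sq.integrableOn.add
    (integrable_exp_neg_sq_mul_bump A).integrableOn).const_mul _).add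
    (integrableOn_exp_neg_sq_div_sqrt.const_mul _)

theorem integral_oscMajorant_le {A : ℝ} (hA : A ≠ 0) :
    ∫ t in Set.Ioi (0:ℝ), Real.exp (-t ^ 2) * oscMajorant A t ≤
      1 / 2 / Real.sqrt |A| ^ 3 * (Real.sqrt Real.pi / 2 + 1 / (6 * Real.sqrt |A| ^ 2))
        + 1 / (2 * Real.sqrt |A| ^ 4) * (1 + Real.sqrt Real.pi / 2) := by
  simp only [exp_neg_sq_mul_oscMajorant]
  rw [integral_add, integral_const_mul, integral_const_mul, integral_add, integral_exp_neg_sq_Ioi]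
  · gcongr
    · exact integral_exp_neg_sq_mul_bump_le hA
    · exact integral_exp_neg_sq_div_sqrt_le
  · exact integrable_exp_neg_sq.integrableOn
  · exact (integrable_exp_neg_sq_mul_bump A).integrableOn
  · exact (integrable_exp_neg_sq.integrableOn.add
      (integrable_exp_neg_sq_mul_bump A).integrableOn).const_mul _
  · exact integrableOn_exp_neg_sq_div_sqrt.const_mul _

/-- Gaussian tail of the oscillatory primitive. -/
noncomputable def gaussTail (A x : ℝ) : ℂ :=
  ∫ t in Set.Ioi x, (Real.exp (-t ^ 2) : ℂ) * oscPrim A t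

theorem norm_exp_mul (t : ℝ) (z : ℂ) :
    ‖(Real.exp (-t ^ 2) : ℂ) * z‖ = Real.exp (-t ^ 2) * ‖z‖ := by
  rw [norm_mul, Complex.norm_real, Real.norm_of_nonneg (Real.exp_pos _).le]

theorem continuous_exp_neg_sq : Continuous fun t : ℝ => (Real.exp (-t ^ 2) : ℂ) := by fun_prop

theorem integrable_exp_mul_oscPrim {A : ℝ} (hA : A ≠ 0) :
    Integrable fun t : ℝ => (Real.exp (-t ^ 2) : ℂ) * oscPrim A t := by
  refine ((integrable_mul_exp_neg_mul_sq (b := 1) one_pos).norm.const_mul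
    (2 / Real.sqrt 3 / Real.sqrt |A|)).mono'
    (continuous_exp_neg_sq.mul (continuous_oscPrim A)).aestronglyMeasurable
    (Filter.Eventually.of_forall fun t => ?_)
  rw [norm_exp_mul, norm_mul, Real.norm_of_nonneg (Real.exp_pos _).le, Real.norm_eq_abs]
  have : ‖oscPrim A t‖ ≤ 2 / Real.sqrt 3 / Real.sqrt |A| * |t| := by
    rcases le_total 0 t with ht | ht
    · rw [abs_of_nonneg ht]; exact norm_oscPrim_le_linear hA ht
    · rw [oscPrim_of_nonpos A ht, norm_zero]; positivity
  rw [neg_one_mul]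
  nlinarith [mul_le_mul_of_nonneg_left this (Real.exp_pos (-t ^ 2)).le]

theorem integral_mul_exp_neg_sq_Ioi (x : ℝ) :
    IntegrableOn (fun t : ℝ => t * Real.exp (-t ^ 2)) (Set.Ioi x) ∧
    ∫ t in Set.Ioi x, t * Real.exp (-t ^ 2) = Real.exp (-x ^ 2) / 2 := by
  have hint : Integrable fun t : ℝ => t * Real.exp (-t ^ 2) := by
    simpa using integrable_mul_exp_neg_mul_sq (b := 1) one_pos
  refine ⟨hint.integrableOn, ?_⟩
  have hlim : Filter.Tendsto (fun t : ℝ => -(Real.exp (-t ^ 2) / 2)) Filter.atTop (nhds 0) := by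
    have := (Real.tendsto_exp_neg_atTop_nhds_zero.comp
      (Filter.tendsto_pow_atTop (two_ne_zero))).div_const 2 |>.neg
    simpa using this
  rw [integral_Ioi_of_hasDerivAt_of_tendsto' (f := fun t => -(Real.exp (-t ^ 2) / 2))
    (fun t _ => ?_) hint.integrableOn hlim]
  · ring
  · refine ((((hasDerivAt_pow 2 t).neg).exp.div_const 2).neg).congr_deriv ?_
    push_cast
    simp
    ring

/-- Bound on the Gaussian tail which is sharp for small `|A|`. -/
theorem norm_gaussTail_le_of_small {A x : ℝ} (hA : A ≠ 0) (hx : 0 ≤ x) :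
    ‖gaussTail A x‖ ≤ 1 / Real.sqrt 3 / Real.sqrt |A| * Real.exp (-x ^ 2) := by
  have h := integral_mul_exp_neg_sq_Ioi x
  calc ‖gaussTail A x‖ ≤ ∫ t in Set.Ioi x, 2 / Real.sqrt 3 / Real.sqrt |A| * (t * Real.exp (-t ^ 2)) := by
        refine norm_integral_le_of_norm_le (h.1.const_mul _) ?_
        filter_upwards [self_mem_ae_restrict measurableSet_Ioi] with t ht
        rw [norm_exp_mul]
        have := norm_oscPrim_le_linear hA (hx.trans (le_of_lt ht))
        nlinarith [mul_le_mul_of_nonneg_left this (Real.exp_pos (-t ^ 2)).le]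
    _ = _ := by rw [integral_const_mul, h.2]; ring

/-- The boundary term produced by integrating `e^{-t²} e^{iAt} t^{1/2} / (iA)` by parts. -/
noncomputable def boundaryTerm (A t : ℝ) : ℂ :=
  (Real.exp (-t ^ 2) : ℂ) * (phase A t *
    ((Real.sqrt t : ℂ) / (Complex.I * A * (Complex.I * A - 2 * t))))

theorem I_mul_sub_ne_zero {A : ℝ} (hA : A ≠ 0) (t : ℝ) : Complex.I * A - 2 * t ≠ 0 := by
  intro h
  have := congrArg Complex.im h
  simp at this
  exact hA this

theorem norm_I_mul_sub_sq (A t : ℝ) : ‖Complex.I * A - 2 * t‖ ^ 2 = A ^ 2 + 4 * t ^ 2 := by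
  rw [← Complex.normSq_eq_norm_sq, Complex.normSq_apply]
  simp
  ring

theorem norm_I_mul_add_eq (A t : ℝ) : ‖Complex.I * A + 2 * t‖ = ‖Complex.I * A - 2 * t‖ := by
  have h : ‖Complex.I * A + 2 * t‖ ^ 2 = ‖Complex.I * A - 2 * t‖ ^ 2 := by
    have := norm_I_mul_sub_sq A (-t)
    rw [norm_I_mul_sub_sq]
    push_cast at this
    rw [show Complex.I * A + 2 * t = Complex.I * A - 2 * -(t : ℂ) by ring, this]
    ring
  exact (pow_left_inj₀ (norm_nonneg _) (norm_nonneg _) two_ne_zero).1 h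

theorem abs_le_norm_I_mul_sub (A t : ℝ) : |A| ≤ ‖Complex.I * A - 2 * t‖ := by
  refine abs_le_of_sq_le_sq' ?_ (norm_nonneg _) |>.2
  rw [norm_I_mul_sub_sq, sq_abs]
  nlinarith [sq_nonneg t]

theorem norm_boundaryTerm_le {A : ℝ} (hA : A ≠ 0) {t : ℝ} (ht : 0 ≤ t) :
    ‖boundaryTerm A t‖ ≤ Real.exp (-t ^ 2) * (1 / 2 / Real.sqrt |A| ^ 3) := by
  have hs : 0 < Real.sqrt |A| := Real.sqrt_pos.2 (abs_pos.2 hA)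
  have hA2 : |A| = Real.sqrt |A| ^ 2 := (Real.sq_sqrt (abs_nonneg A)).symm
  have h1 : 2 * Real.sqrt |A| * Real.sqrt t ≤ ‖Complex.I * A - 2 * t‖ := by
    refine abs_le_of_sq_le_sq' ?_ (norm_nonneg _) |>.2
    rw [norm_I_mul_sub_sq, mul_pow, mul_pow, Real.sq_sqrt ht, ← hA2, ← sq_abs A]
    nlinarith [sq_nonneg (|A| - 2 * t)]
  have h2 : 0 < ‖Complex.I * A - 2 * t‖ := norm_pos_iff.2 (I_mul_sub_ne_zero hA t)
  rw [boundaryTerm, norm_exp_mul]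
  refine mul_le_mul_of_nonneg_left ?_ (Real.exp_pos _).le
  rw [norm_mul, norm_phase, one_mul, norm_div, norm_mul, norm_mul, Complex.norm_I, one_mul,
    Complex.norm_real, Complex.norm_real, Real.norm_of_nonneg (Real.sqrt_nonneg t),
    Real.norm_eq_abs, div_div, div_le_div_iff₀ (by positivity) (by positivity)]
  nlinarith [mul_le_mul_of_nonneg_left h1 (sq_nonneg (Real.sqrt |A|))]

theorem boundaryTerm_zero (A : ℝ) : boundaryTerm A 0 = 0 := by simp [boundaryTerm]

theorem continuous_boundaryTerm {A : ℝ} (hA : A ≠ 0) : Continuous (boundaryTerm A) := by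
  refine continuous_exp_neg_sq.mul ((continuous_phase A).mul ((by fun_prop :
    Continuous fun t : ℝ => (Real.sqrt t : ℂ)).div (by fun_prop) fun t => ?_))
  have hA' : (A : ℂ) ≠ 0 := by exact_mod_cast hA
  simp [hA', I_mul_sub_ne_zero hA t]

/-- The part of the derivative of `boundaryTerm` coming from its amplitude. -/
noncomputable def amplitudeDeriv (A t : ℝ) : ℂ :=
  phase A t * ((Complex.I * A + 2 * t) /
    (2 * (Real.sqrt t : ℂ) * (Complex.I * A - 2 * t) ^ 2 * (Complex.I * A)))

theorem hasDerivAt_boundaryTerm {A t : ℝ} (hA : A ≠ 0) (ht : 0 < t) :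
    HasDerivAt (boundaryTerm A) ((Real.exp (-t ^ 2) : ℂ) *
      (phase A t * (Real.sqrt t : ℂ) / (Complex.I * A) + amplitudeDeriv A t)) t := by
  have hA' : (A : ℂ) ≠ 0 := by exact_mod_cast hA
  have hs : (Real.sqrt t : ℂ) ≠ 0 := by exact_mod_cast (Real.sqrt_pos.2 ht).ne'
  have hne := I_mul_sub_ne_zero hA t
  have h1 : HasDerivAt (fun y : ℝ => (Real.exp (-y ^ 2) : ℂ))
      ((Real.exp (-t ^ 2) * -(2 * t) : ℝ) : ℂ) t := by
    refine HasDerivAt.ofReal_comp (((hasDerivAt_pow 2 t).neg.exp).congr_deriv ?_)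
    simp
  have h2 : HasDerivAt (fun y : ℝ => Complex.I * A * (Complex.I * A - 2 * (y : ℂ)))
      (Complex.I * A * -(2 * 1)) t :=
    (((Complex.ofRealCLM.hasDerivAt (x := t)).const_mul 2).const_sub _).const_mul _
  have h3 := h1.mul ((hasDerivAt_phase A t).mul ((hasDerivAt_ofReal_sqrt ht).div h2
    (mul_ne_zero (mul_ne_zero Complex.I_ne_zero hA') hne)))
  refine h3.congr_deriv ?_
  have hs2 : (Real.sqrt t : ℂ) ^ 2 = t := by exact_mod_cast Real.sq_sqrt ht.le
  simp only [Pi.mul_apply, Pi.div_apply, amplitudeDeriv]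
  rw [← hs2] at hne ⊢
  push_cast
  field_simp
  linear_combination phase A t *
    (4 * (Real.sqrt t : ℂ) ^ 2 * Complex.I * A - 8 * (Real.sqrt t : ℂ) ^ 4) * hs2

theorem norm_amplitudeDeriv_le {A t : ℝ} (hA : A ≠ 0) (ht : 0 < t) :
    ‖amplitudeDeriv A t‖ ≤ 1 / (2 * Real.sqrt |A| ^ 4) * (1 / Real.sqrt t) := by
  have hA0 : 0 < |A| := abs_pos.2 hA
  have hs : 0 < Real.sqrt t := Real.sqrt_pos.2 ht
  have h2 : 0 < ‖Complex.I * A - 2 * t‖ := norm_pos_iff.2 (I_mul_sub_ne_zero hA t)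
  rw [show Real.sqrt |A| ^ 4 = (Real.sqrt |A| ^ 2) ^ 2 by ring, Real.sq_sqrt hA0.le,
    amplitudeDeriv, norm_mul, norm_phase, one_mul, norm_div, norm_mul, norm_mul, norm_mul, norm_mul,
    norm_pow, norm_I_mul_add_eq, Complex.norm_I, one_mul, Complex.norm_real, Complex.norm_real,
    Complex.norm_ofNat, Real.norm_of_nonneg hs.le, Real.norm_eq_abs]
  have h3 := abs_le_norm_I_mul_sub A t
  rw [show ‖Complex.I * A - 2 * t‖ / (2 * Real.sqrt t * ‖Complex.I * A - 2 * t‖ ^ 2 * |A|)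
    = 1 / (2 * Real.sqrt t * ‖Complex.I * A - 2 * t‖ * |A|) by field_simp,
    show 1 / (2 * |A| ^ 2) * (1 / Real.sqrt t) = 1 / (2 * Real.sqrt t * |A| * |A|) by
      field_simp]
  gcongr

theorem tendsto_boundaryTerm {A : ℝ} (hA : A ≠ 0) :
    Filter.Tendsto (boundaryTerm A) Filter.atTop (nhds 0) := by
  have h1 : Filter.Tendsto (fun t : ℝ => Real.exp (-t ^ 2) * (1 / 2 / Real.sqrt |A| ^ 3))
      Filter.atTop (nhds 0) := by
    simpa using (Real.tendsto_exp_neg_atTop_nhds_zero.comp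
      (Filter.tendsto_pow_atTop (two_ne_zero))).mul_const (1 / 2 / Real.sqrt |A| ^ 3)
  refine squeeze_zero_norm' ?_ h1
  filter_upwards [Filter.eventually_ge_atTop 0] with t ht
  exact norm_boundaryTerm_le hA ht

/-- Up to a constant multiple of the Gaussian tail and an explicit boundary term, `gaussTail` is
controlled by the majorant. -/
theorem exists_norm_gaussTail_sub_le {A : ℝ} (hA : A ≠ 0) :
    ∃ c : ℂ, ‖c‖ ≤ 1 / Real.sqrt |A| ^ 3 ∧ ∀ x, 0 ≤ x →
      ‖gaussTail A x - c * ((∫ t in Set.Ioi x, Real.exp (-t ^ 2) : ℝ) : ℂ)‖ ≤ ‖boundaryTerm A x‖ +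
        Real.exp (-x ^ 2) * ∫ t in Set.Ioi 0, Real.exp (-t ^ 2) * oscMajorant A t := by
  obtain ⟨c, hc, hbound⟩ := exists_norm_oscRem_sub_le hA
  refine ⟨c, hc, fun x hx => ?_⟩
  set e : ℝ → ℂ := fun t => (Real.exp (-t ^ 2) : ℂ) with he
  set E : ℝ → ℂ := fun t => oscRem A t - c - amplitudeDeriv A t with hE
  have hEle : ∀ t, 0 < t → ‖E t‖ ≤ oscMajorant A t := fun t ht =>
    (norm_sub_le _ _).trans (add_le_add (hbound t ht.le) (norm_amplitudeDeriv_le hA ht))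
  have hA' : (A : ℂ) ≠ 0 := by exact_mod_cast hA
  have hmeas : Measurable E := by
    refine ((continuous_oscRem A).measurable.sub_const c).sub ?_
    exact (continuous_phase A).measurable.mul (by fun_prop)
  have hsub : Set.Ioi x ⊆ Set.Ioi 0 := Set.Ioi_subset_Ioi hx
  have hmaj : IntegrableOn (fun t => Real.exp (-t ^ 2) * oscMajorant A t) (Set.Ioi x) :=
    (integrableOn_oscMajorant A).mono_set hsub
  have hEnorm : ∀ᵐ t ∂(volume.restrict (Set.Ioi x)),
      ‖e t * E t‖ ≤ Real.exp (-t ^ 2) * oscMajorant A t := by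
    filter_upwards [self_mem_ae_restrict measurableSet_Ioi] with t ht
    rw [he, norm_exp_mul]
    exact mul_le_mul_of_nonneg_left (hEle t (hsub ht)) (Real.exp_pos _).le
  have hEint : IntegrableOn (fun t => e t * E t) (Set.Ioi x) :=
    hmaj.mono' (continuous_exp_neg_sq.measurable.mul hmeas).aestronglyMeasurable hEnorm
  have hcint : IntegrableOn (fun t => e t * c) (Set.Ioi x) :=
    (integrable_exp_neg_sq.ofReal.mul_const c).integrableOn
  have hHint : IntegrableOn (fun t => e t * oscPrim A t) (Set.Ioi x) :=
    (integrable_exp_mul_oscPrim hA).integrableOn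
  have hsplit : ∀ t, e t * (phase A t * (Real.sqrt t : ℂ) / (Complex.I * A) + amplitudeDeriv A t)
      = e t * oscPrim A t - e t * c - e t * E t := by
    intro t
    simp only [hE, oscRem]
    ring
  have hparts := integral_Ioi_of_hasDerivAt_of_tendsto
    (continuous_boundaryTerm hA).continuousWithinAt
    (fun t ht => hasDerivAt_boundaryTerm hA (hsub ht))
    (((hHint.sub hcint).sub hEint).congr_fun (fun t _ => (hsplit t).symm) measurableSet_Ioi)
    (tendsto_boundaryTerm hA)
  have hI : ∫ t in Set.Ioi x, e t * c = c * ((∫ t in Set.Ioi x, Real.exp (-t ^ 2) : ℝ) : ℂ) := by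
    rw [integral_mul_const, mul_comm]
    exact congrArg (c * ·) integral_ofReal
  rw [setIntegral_congr_fun measurableSet_Ioi (fun t _ => hsplit t),
    integral_sub (f := fun t => e t * oscPrim A t - e t * c) (hHint.sub hcint) hEint,
    integral_sub hHint hcint, hI] at hparts
  have key : gaussTail A x - c * ((∫ t in Set.Ioi x, Real.exp (-t ^ 2) : ℝ) : ℂ)
      = -boundaryTerm A x + ∫ t in Set.Ioi x, e t * E t := by
    rw [gaussTail]
    linear_combination hparts
  rw [key]
  refine (norm_add_le _ _).trans ?_
  rw [norm_neg]
  refine add_le_add le_rfl ((norm_integral_le_of_norm_le hmaj hEnorm).trans ?_)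
  exact setIntegral_exp_neg_sq_mul_le (antitoneOn_oscMajorant A)
    (fun t _ => oscMajorant_nonneg A t) (integrableOn_oscMajorant A) hx

/-- The constant making the Gaussian mean of `oscPrim A + oscShift A` over `ℝ` vanish. -/
noncomputable def oscShift (A : ℝ) : ℂ := -(gaussTail A 0 / (Real.sqrt Real.pi : ℂ))

/-- The Gaussian tail of `oscPrim A + oscShift A`. -/
noncomputable def shiftedTail (A x : ℝ) : ℂ :=
  ∫ t in Set.Ioi x, (Real.exp (-t ^ 2) : ℂ) * (oscPrim A t + oscShift A)

theorem integrable_exp_mul_shifted {A : ℝ} (hA : A ≠ 0) :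
    Integrable fun t : ℝ => (Real.exp (-t ^ 2) : ℂ) * (oscPrim A t + oscShift A) := by
  simp only [mul_add]
  exact (integrable_exp_mul_oscPrim hA).add (integrable_exp_neg_sq.ofReal.mul_const _)

theorem shiftedTail_eq {A : ℝ} (hA : A ≠ 0) (x : ℝ) :
    shiftedTail A x = gaussTail A x +
      oscShift A * ((∫ t in Set.Ioi x, Real.exp (-t ^ 2) : ℝ) : ℂ) := by
  have hI : Integrable fun t : ℝ => (Real.exp (-t ^ 2) : ℂ) * oscShift A :=
    integrable_exp_neg_sq.ofReal.mul_const _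
  simp only [shiftedTail, gaussTail, mul_add]
  rw [integral_add (integrable_exp_mul_oscPrim hA).integrableOn hI.integrableOn,
    integral_mul_const, mul_comm (oscShift A)]
  exact congrArg (_ + · * _) integral_ofReal

theorem norm_oscShift_mul (A : ℝ) : ‖oscShift A‖ * Real.sqrt Real.pi = ‖gaussTail A 0‖ := by
  have hpi : 0 < Real.sqrt Real.pi := Real.sqrt_pos.2 Real.pi_pos
  rw [oscShift, norm_neg, norm_div, Complex.norm_real, Real.norm_of_nonneg hpi.le,
    div_mul_cancel₀ _ hpi.ne']

theorem norm_ofReal_gaussTail_le {x : ℝ} (hx : 0 ≤ x) :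
    ‖((∫ t in Set.Ioi x, Real.exp (-t ^ 2) : ℝ) : ℂ)‖
      ≤ Real.exp (-x ^ 2) * (Real.sqrt Real.pi / 2) := by
  rw [Complex.norm_real, Real.norm_of_nonneg (integral_nonneg fun t => (Real.exp_pos _).le)]
  exact setIntegral_exp_neg_sq_le hx

theorem sqrt_pi_le : Real.sqrt Real.pi ≤ 1.7725 := by
  rw [Real.sqrt_le_left (by norm_num)]
  linarith [Real.pi_lt_d4]

theorem norm_shiftedTail_le_of_small {A x : ℝ} (hA : A ≠ 0) (hs : Real.sqrt |A| ≤ 1.69)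
    (hx : 0 ≤ x) : ‖shiftedTail A x‖ ≤ Real.exp (-x ^ 2) * (5 / 2 / Real.sqrt |A| ^ 3) := by
  have hs0 : 0 < Real.sqrt |A| := Real.sqrt_pos.2 (abs_pos.2 hA)
  set s := Real.sqrt |A|
  have hG := norm_gaussTail_le_of_small hA hx
  have hG0 := norm_gaussTail_le_of_small hA le_rfl
  have hq := norm_ofReal_gaussTail_le hx
  have hC := norm_oscShift_mul A
  rw [show Real.exp (-(0:ℝ) ^ 2) = 1 by simp, mul_one] at hG0
  have hnum : 1 / Real.sqrt 3 / s * (3 / 2) ≤ 5 / 2 / s ^ 3 := by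
    have h3 : Real.sqrt 3 ≤ 1.7321 := by
      rw [Real.sqrt_le_left (by norm_num)]; norm_num
    have h3' : Real.sqrt 3 ^ 2 = 3 := Real.sq_sqrt (by norm_num)
    have h30 : 0 < Real.sqrt 3 := by positivity
    have e : 1 / Real.sqrt 3 / s * (3 / 2) = Real.sqrt 3 * s ^ 2 / 2 / s ^ 3 := by
      field_simp
      linear_combination -h3'
    rw [e]
    gcongr
    nlinarith [mul_le_mul h3 (pow_le_pow_left₀ hs0.le hs 2) (by positivity) (by norm_num)]
  rw [shiftedTail_eq hA]
  calc _ ≤ 1 / Real.sqrt 3 / s * Real.exp (-x ^ 2) +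
        ‖oscShift A‖ * (Real.exp (-x ^ 2) * (Real.sqrt Real.pi / 2)) := by
        refine (norm_add_le _ _).trans (add_le_add hG ?_)
        rw [norm_mul]
        gcongr
    _ = Real.exp (-x ^ 2) * (1 / Real.sqrt 3 / s + ‖gaussTail A 0‖ / 2) := by
        rw [← hC]; ring
    _ ≤ Real.exp (-x ^ 2) * (5 / 2 / s ^ 3) := by
        gcongr
        linarith

theorem norm_shiftedTail_le_of_large {A x : ℝ} (hA : A ≠ 0) (hs : 1.69 ≤ Real.sqrt |A|)
    (hx : 0 ≤ x) : ‖shiftedTail A x‖ ≤ Real.exp (-x ^ 2) * (5 / 2 / Real.sqrt |A| ^ 3) := by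
  have hs0 : 0 < Real.sqrt |A| := Real.sqrt_pos.2 (abs_pos.2 hA)
  obtain ⟨c, hc, hN⟩ := exists_norm_gaussTail_sub_le hA
  have hJ := integral_oscMajorant_le hA
  have hb := norm_boundaryTerm_le hA hx
  have hNx := hN x hx
  have hN0 := hN 0 le_rfl
  have hq := norm_ofReal_gaussTail_le hx
  have hpi : 0 < Real.sqrt Real.pi := Real.sqrt_pos.2 Real.pi_pos
  have hpi' : (Real.sqrt Real.pi : ℂ) ≠ 0 := by exact_mod_cast hpi.ne'
  have hpi2 := sqrt_pi_le
  set s := Real.sqrt |A|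
  set J := ∫ t in Set.Ioi (0:ℝ), Real.exp (-t ^ 2) * oscMajorant A t
  set q : ℂ := ((∫ t in Set.Ioi x, Real.exp (-t ^ 2) : ℝ) : ℂ)
  rw [boundaryTerm_zero, norm_zero, zero_add, show Real.exp (-(0:ℝ) ^ 2) = 1 by simp, one_mul,
    integral_exp_neg_sq_Ioi] at hN0
  have hdecomp : shiftedTail A x = c * q / 2 + (gaussTail A x - c * q) -
      (gaussTail A 0 - c * ((Real.sqrt Real.pi / 2 : ℝ) : ℂ)) / (Real.sqrt Real.pi : ℂ) * q := by
    rw [shiftedTail_eq hA, oscShift]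
    push_cast
    field_simp
    ring
  have hnum : Real.sqrt Real.pi / 4 * (1 / s ^ 3) + 1 / 2 / s ^ 3 + 3 / 2 * J ≤ 5 / 2 / s ^ 3 := by
    have hinv : 1 / s ≤ 1 / 1.69 := one_div_le_one_div_of_le (by norm_num) hs
    have hinv0 : 0 < 1 / s := by positivity
    have hJ' : J ≤ (1 / 2 * (Real.sqrt Real.pi / 2 + 1 / 6 * (1 / s) ^ 2) +
        1 / 2 * (1 / s) * (1 + Real.sqrt Real.pi / 2)) * (1 / s ^ 3) := by
      refine hJ.trans_eq ?_
      field_simp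
    have hsq : (1 / s) ^ 2 ≤ (1 / 1.69) ^ 2 := by gcongr
    have hprod : (1 / s) * (1 + Real.sqrt Real.pi / 2) ≤ 1 / 1.69 * (1 + 1.7725 / 2) := by
      gcongr
    have hJ'' : J ≤ (1 / 2 * (1.7725 / 2 + 1 / 6 * (1 / 1.69) ^ 2) +
        1 / 2 * (1 / 1.69 * (1 + 1.7725 / 2))) * (1 / s ^ 3) := by
      refine hJ'.trans (mul_le_mul_of_nonneg_right ?_ (by positivity))
      linarith
    have hp : Real.sqrt Real.pi / 4 * (1 / s ^ 3) ≤ 1.7725 / 4 * (1 / s ^ 3) := by gcongr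
    have e1 : 1 / 2 / s ^ 3 = 1 / 2 * (1 / s ^ 3) := by ring
    have e2 : 5 / 2 / s ^ 3 = 5 / 2 * (1 / s ^ 3) := by ring
    have hpos : 0 < 1 / s ^ 3 := by positivity
    rw [e1, e2]
    nlinarith
  rw [hdecomp]
  set E := Real.exp (-x ^ 2)
  have hE : 0 < E := Real.exp_pos _
  have hq0 := norm_nonneg q
  calc _ ≤ ‖c‖ * ‖q‖ / 2 + ‖gaussTail A x - c * q‖ +
        ‖gaussTail A 0 - c * ((Real.sqrt Real.pi / 2 : ℝ) : ℂ)‖ / Real.sqrt Real.pi * ‖q‖ := by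
        refine (norm_sub_le _ _).trans (add_le_add ((norm_add_le _ _).trans_eq ?_) (le_of_eq ?_))
        · rw [norm_div, norm_mul, Complex.norm_two]
        · rw [norm_mul, norm_div, Complex.norm_real, Real.norm_of_nonneg hpi.le]
    _ ≤ 1 / s ^ 3 * (E * (Real.sqrt Real.pi / 2)) / 2 + (E * (1 / 2 / s ^ 3) + E * J) +
        J / Real.sqrt Real.pi * (E * (Real.sqrt Real.pi / 2)) := by
        have hJ0 : 0 ≤ J := (norm_nonneg _).trans hN0
        gcongr
        exact hNx.trans (add_le_add hb le_rfl)
    _ = E * (Real.sqrt Real.pi / 4 * (1 / s ^ 3) + 1 / 2 / s ^ 3 + 3 / 2 * J) := by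
        field_simp
        ring
    _ ≤ _ := mul_le_mul_of_nonneg_left hnum hE.le

theorem norm_shiftedTail_le_of_nonneg {A x : ℝ} (hA : A ≠ 0) (hx : 0 ≤ x) :
    ‖shiftedTail A x‖ ≤ Real.exp (-x ^ 2) * (5 / 2 / Real.sqrt |A| ^ 3) :=
  (le_total (Real.sqrt |A|) 1.69).elim (fun hs => norm_shiftedTail_le_of_small hA hs hx)
    (fun hs => norm_shiftedTail_le_of_large hA hs hx)

theorem shiftedTail_eq_of_nonpos {A x : ℝ} (hA : A ≠ 0) (hx : x ≤ 0) :
    shiftedTail A x = -(oscShift A * ((∫ t in Set.Ioi (-x), Real.exp (-t ^ 2) : ℝ) : ℂ)) := by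
  have hIic : ∀ y : ℝ, y ≤ 0 →
      ∫ t in Set.Iic y, (Real.exp (-t ^ 2) : ℂ) * (oscPrim A t + oscShift A)
        = oscShift A * ((∫ t in Set.Ioi (-y), Real.exp (-t ^ 2) : ℝ) : ℂ) := by
    intro y hy
    have h1 := integral_comp_neg_Iic y fun t => Real.exp (-t ^ 2)
    simp only [neg_sq] at h1
    have h2 : ∫ t in Set.Iic y, (Real.exp (-t ^ 2) : ℂ)
        = ((∫ t in Set.Iic y, Real.exp (-t ^ 2) : ℝ) : ℂ) := integral_ofReal
    rw [← h1, mul_comm, ← h2, ← integral_mul_const]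
    refine setIntegral_congr_fun measurableSet_Iic fun t ht => ?_
    simp [oscPrim_of_nonpos A (le_trans ht hy)]
  have hI := integrable_exp_mul_shifted hA
  have hsplit : ∀ y : ℝ, y ≤ 0 →
      oscShift A * ((∫ t in Set.Ioi (-y), Real.exp (-t ^ 2) : ℝ) : ℂ) + shiftedTail A y
        = ∫ t : ℝ, (Real.exp (-t ^ 2) : ℂ) * (oscPrim A t + oscShift A) := by
    intro y hy
    rw [← hIic y hy]
    exact intervalIntegral.integral_Iic_add_Ioi hI.integrableOn hI.integrableOn
  have h0 := hsplit 0 le_rfl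
  have hpi' : (Real.sqrt Real.pi : ℂ) ≠ 0 := by
    exact_mod_cast (Real.sqrt_pos.2 Real.pi_pos).ne'
  rw [shiftedTail_eq hA, neg_zero, integral_exp_neg_sq_Ioi] at h0
  have hz : oscShift A * ((Real.sqrt Real.pi / 2 : ℝ) : ℂ) + (gaussTail A 0 +
      oscShift A * ((Real.sqrt Real.pi / 2 : ℝ) : ℂ)) = 0 := by
    rw [oscShift]
    push_cast
    field_simp
    ring
  linear_combination hsplit x hx - h0 + hz

theorem norm_shiftedTail_le {A : ℝ} (hA : A ≠ 0) (x : ℝ) :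
    ‖shiftedTail A x‖ ≤ Real.exp (-x ^ 2) * (5 / 2 / Real.sqrt |A| ^ 3) := by
  rcases le_total 0 x with hx | hx
  · exact norm_shiftedTail_le_of_nonneg hA hx
  have h0 := norm_shiftedTail_le_of_nonneg hA le_rfl
  have hq := norm_ofReal_gaussTail_le (neg_nonneg.2 hx)
  rw [shiftedTail_eq_of_nonpos hA le_rfl, neg_zero, norm_neg, norm_mul, integral_exp_neg_sq_Ioi,
    Complex.norm_real, Real.norm_of_nonneg (by positivity), show Real.exp (-(0:ℝ) ^ 2) = 1 by simp,
    one_mul] at h0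
  rw [shiftedTail_eq_of_nonpos hA hx, norm_neg, norm_mul]
  rw [neg_sq] at hq
  calc _ ≤ ‖oscShift A‖ * (Real.exp (-x ^ 2) * (Real.sqrt Real.pi / 2)) := by gcongr
    _ = Real.exp (-x ^ 2) * (‖oscShift A‖ * (Real.sqrt Real.pi / 2)) := by ring
    _ ≤ _ := by gcongr

/-- The bounded solution `k` of `k' = 2 x k + 2 (oscPrim A + oscShift A)`. -/
noncomputable def dualKernel (A x : ℝ) : ℂ := -2 * (Real.exp (x ^ 2) : ℂ) * shiftedTail A x

theorem norm_dualKernel_le {A : ℝ} (hA : A ≠ 0) (x : ℝ) :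
    ‖dualKernel A x‖ ≤ 5 / Real.sqrt |A| ^ 3 := by
  have hE := Real.exp_pos (x ^ 2)
  rw [dualKernel, norm_mul, norm_mul, norm_neg, Complex.norm_two, Complex.norm_real,
    Real.norm_of_nonneg hE.le]
  calc _ ≤ 2 * Real.exp (x ^ 2) * (Real.exp (-x ^ 2) * (5 / 2 / Real.sqrt |A| ^ 3)) := by
        gcongr
        exact norm_shiftedTail_le hA x
    _ = _ := by
        rw [Real.exp_neg]
        field_simp

theorem hasDerivAt_shiftedTail {A : ℝ} (hA : A ≠ 0) (x : ℝ) :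
    HasDerivAt (shiftedTail A) (-((Real.exp (-x ^ 2) : ℂ) * (oscPrim A x + oscShift A))) x := by
  have hI := integrable_exp_mul_shifted hA
  have hcont : Continuous fun t : ℝ => (Real.exp (-t ^ 2) : ℂ) * (oscPrim A t + oscShift A) :=
    continuous_exp_neg_sq.mul ((continuous_oscPrim A).add continuous_const)
  have heq : shiftedTail A = fun y => shiftedTail A 0 -
      ∫ t in (0:ℝ)..y, (Real.exp (-t ^ 2) : ℂ) * (oscPrim A t + oscShift A) := by
    funext y
    rw [shiftedTail, shiftedTail,
      ← intervalIntegral.integral_interval_add_Ioi (a := 0) (b := y) hI.integrableOn hI.integrableOn]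
    ring
  rw [heq]
  exact (hcont.integral_hasStrictDerivAt 0 x).hasDerivAt.const_sub _

theorem hasDerivAt_dualKernel {A : ℝ} (hA : A ≠ 0) (x : ℝ) :
    HasDerivAt (dualKernel A) (2 * x * dualKernel A x + 2 * (oscPrim A x + oscShift A)) x := by
  have h1 : HasDerivAt (fun y : ℝ => (Real.exp (y ^ 2) : ℂ))
      ((Real.exp (x ^ 2) * (2 * x) : ℝ) : ℂ) x := by
    refine HasDerivAt.ofReal_comp (((hasDerivAt_pow 2 x).exp).congr_deriv ?_)
    simp
  refine ((h1.const_mul (-2)).mul (hasDerivAt_shiftedTail hA x)).congr_deriv ?_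
  have hE : (Real.exp (x ^ 2) : ℂ) * (Real.exp (-x ^ 2) : ℂ) = 1 := by
    rw [← Complex.ofReal_mul, ← Real.exp_add]
    simp
  rw [dualKernel]
  push_cast at hE ⊢
  linear_combination 2 * (oscPrim A x + oscShift A) * hE

theorem contDiff_one_deriv {χ : ℝ → ℂ} (hχ : ContDiff ℝ 2 χ) : ContDiff ℝ 1 (deriv χ) := by
  have h : ContDiff ℝ (1 + 1) χ := by rwa [one_add_one_eq_two]
  exact (contDiff_succ_iff_deriv.1 h).2.2

theorem integral_phase_mul_sqrt_eq {χ : ℝ → ℂ} (hχ : ContDiff ℝ 2 χ) (hsupp : HasCompactSupport χ)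
    {A : ℝ} (hA : A ≠ 0) :
    ∫ l in Set.Ioi (0:ℝ), phase A l * χ l * (Real.sqrt l : ℂ)
      = ∫ l : ℝ, (deriv (deriv χ) l / 2 + (l : ℂ) * deriv χ l) * dualKernel A l := by
  have hχ1 : ContDiff ℝ 1 (deriv χ) := contDiff_one_deriv hχ
  have hd : ∀ x, HasDerivAt χ (deriv χ x) x :=
    fun x => (hχ.differentiable (by norm_num) x).hasDerivAt
  have hd1 : ∀ x, HasDerivAt (deriv χ) (deriv (deriv χ) x) x :=
    fun x => (hχ1.differentiable (by norm_num) x).hasDerivAt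
  have hc0 := hχ.continuous
  have hc1 := hχ1.continuous
  have hc2 : Continuous (deriv (deriv χ)) := hχ1.continuous_deriv le_rfl
  have hk : Continuous (dualKernel A) :=
    continuous_iff_continuousAt.2 fun x => (hasDerivAt_dualKernel hA x).continuousAt
  have hg : Continuous fun t => oscPrim A t + oscShift A :=
    (continuous_oscPrim A).add continuous_const
  have hps := continuous_phase_mul_sqrt A
  have hk' : Continuous fun t : ℝ => 2 * t * dualKernel A t + 2 * (oscPrim A t + oscShift A) := by
    fun_prop
  have int0 : ∀ {f : ℝ → ℂ}, Continuous f → Integrable fun t => f t * χ t := fun hf =>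
    (hf.mul hc0).integrable_of_hasCompactSupport hsupp.mul_left
  have int1 : ∀ {f : ℝ → ℂ}, Continuous f → Integrable fun t => f t * deriv χ t := fun hf =>
    (hf.mul hc1).integrable_of_hasCompactSupport hsupp.deriv.mul_left
  have int2 : ∀ {f : ℝ → ℂ}, Continuous f → Integrable fun t => f t * deriv (deriv χ) t :=
    fun hf => (hf.mul hc2).integrable_of_hasCompactSupport hsupp.deriv.deriv.mul_left
  have hp1 : ∫ t, (oscPrim A t + oscShift A) * deriv χ t
      = -∫ t, phase A t * (Real.sqrt t : ℂ) * χ t :=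
    integral_mul_deriv_eq_deriv_mul_of_integrable
      (fun x _ => (hasDerivAt_oscPrim A x).add_const _) (fun x _ => hd x)
      (int1 hg) (int0 hps) (int0 hg)
  have hp2 : ∫ t, dualKernel A t * deriv (deriv χ) t
      = -∫ t : ℝ, (2 * t * dualKernel A t + 2 * (oscPrim A t + oscShift A)) * deriv χ t :=
    integral_mul_deriv_eq_deriv_mul_of_integrable
      (fun x _ => hasDerivAt_dualKernel hA x) (fun x _ => hd1 x)
      (int2 hk) (int1 hk') (int1 hk)
  have htk : Continuous fun t : ℝ => (t : ℂ) * dualKernel A t := by fun_prop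
  have hexp : ∫ t : ℝ, (2 * t * dualKernel A t + 2 * (oscPrim A t + oscShift A)) * deriv χ t
      = 2 * (∫ t : ℝ, t * dualKernel A t * deriv χ t) +
        2 * ∫ t, (oscPrim A t + oscShift A) * deriv χ t := by
    rw [← integral_const_mul, ← integral_const_mul,
      ← integral_add ((int1 htk).const_mul 2) ((int1 hg).const_mul 2)]
    exact integral_congr_ae (.of_forall fun t => by ring)
  have hrhs : ∫ t : ℝ, (deriv (deriv χ) t / 2 + (t : ℂ) * deriv χ t) * dualKernel A t
      = 1 / 2 * (∫ t, dualKernel A t * deriv (deriv χ) t) +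
        ∫ t : ℝ, t * dualKernel A t * deriv χ t := by
    rw [← integral_const_mul, ← integral_add ((int2 hk).const_mul (1 / 2)) (int1 htk)]
    exact integral_congr_ae (.of_forall fun t => by ring)
  have hlhs : ∫ t in Set.Ioi (0:ℝ), phase A t * χ t * (Real.sqrt t : ℂ)
      = ∫ t, phase A t * (Real.sqrt t : ℂ) * χ t := by
    rw [setIntegral_eq_integral_of_forall_compl_eq_zero fun t ht => by
      rw [Real.sqrt_eq_zero_of_nonpos (not_lt.1 ht), Complex.ofReal_zero, mul_zero]]
    exact integral_congr_ae (.of_forall fun t => by ring)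
  rw [hlhs, hrhs]
  linear_combination (-1 / 2 : ℂ) * hp2 + (1 / 2 : ℂ) * hexp + hp1

theorem one_div_sqrt_pow_three (a : ℝ) (ha : 0 < a) :
    1 / Real.sqrt a ^ 3 = a ^ (-(3:ℝ) / 2) := by
  rw [Real.sqrt_eq_rpow, ← Real.rpow_natCast, ← Real.rpow_mul ha.le, one_div, ← Real.rpow_neg ha.le]
  norm_num

/-- For every `χ ∈ C²(ℝ)` with compact support and every `A ≠ 0`,
`|∫_0^∞ e^{iλA} χ(λ) λ^{1/2} dλ| ≤ 5 ‖χ''/2 + λχ'‖_{L¹} |A|^{−3/2}`. -/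
theorem stmt14 (χ : ℝ → ℂ) (hχ : ContDiff ℝ 2 χ) (hsupp : HasCompactSupport χ)
    (A : ℝ) (hA : A ≠ 0) :
    ‖∫ l in Set.Ioi (0:ℝ),
        Complex.exp (Complex.I * (l : ℂ) * (A : ℂ)) * χ l * ((Real.sqrt l : ℝ) : ℂ)‖
      ≤ 5 * (∫ l : ℝ, ‖deriv (deriv χ) l / 2 + (l : ℂ) * deriv χ l‖) * |A| ^ (-(3:ℝ)/2) := by
  have hχ1 : ContDiff ℝ 1 (deriv χ) := contDiff_one_deriv hχ
  have hcont : Continuous fun l : ℝ => deriv (deriv χ) l / 2 + (l : ℂ) * deriv χ l := by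
    have hc1 := hχ1.continuous
    have hc2 : Continuous (deriv (deriv χ)) := hχ1.continuous_deriv le_rfl
    fun_prop
  have hcs : HasCompactSupport fun l : ℝ => deriv (deriv χ) l / 2 + (l : ℂ) * deriv χ l := by
    simp only [div_eq_mul_inv]
    exact hsupp.deriv.deriv.mul_right.add hsupp.deriv.mul_left
  have hint := hcont.integrable_of_hasCompactSupport (μ := volume) hcs
  change ‖∫ l in Set.Ioi (0:ℝ), phase A l * χ l * (Real.sqrt l : ℂ)‖ ≤ _
  rw [integral_phase_mul_sqrt_eq hχ hsupp hA, ← one_div_sqrt_pow_three _ (abs_pos.2 hA)]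
  refine (norm_integral_le_of_norm_le (hint.norm.mul_const (5 / Real.sqrt |A| ^ 3))
    (.of_forall fun l => ?_)).trans_eq ?_
  · rw [norm_mul]
    exact mul_le_mul_of_nonneg_left (norm_dualKernel_le hA l) (norm_nonneg _)
  · rw [integral_mul_const]
    ring
end
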